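/- arXiv:2407.16717 — 15 statements merged into one kernel-verified Lean document; each statement's English description precedes it below -/
import Mathlib

section
/- For every positive integer n and every frieze pattern f of type A_n, every value of f is bounded above by the Fibonacci number F_{n+2}; that is, f(i,m) ≤ F_{n+2} for all i ∈ {1,…,n} and all m ∈ ℤ. -/
/-- A frieze pattern of type `Aₙ`: a function on `{1,…,n} × ℤ` with positive values,
encoded as `f : ℕ × ℤ → ℕ` with the conventions `f (0, m) = f (n+1, m) = 1` and the
diamond rule `f(i,m)·f(i,m+1) = 1 + f(i+1,m)·f(i-1,m+1)` for `1 ≤ i ≤ n`. -/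
def IsFriezeA (n : ℕ) (f : ℕ × ℤ → ℕ) : Prop :=
  (∀ m : ℤ, f (0, m) = 1) ∧
  (∀ m : ℤ, f (n + 1, m) = 1) ∧
  (∀ i : ℕ, 1 ≤ i → i ≤ n → ∀ m : ℤ, 0 < f (i, m)) ∧
  (∀ i : ℕ, 1 ≤ i → i ≤ n → ∀ m : ℤ,
    f (i, m) * f (i, m + 1) = 1 + f (i + 1, m) * f (i - 1, m + 1))

/-- The entries of a diagonal of a frieze pattern satisfy a three-term linear recurrence. -/
theorem IsFriezeA.add_eq_mul {n : ℕ} {f : ℕ × ℤ → ℕ} (hf : IsFriezeA n f) {i : ℕ} (hi : i < n)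
    (m : ℤ) : f (i, m) + f (i + 2, m) = f (1, m + i + 1) * f (i + 1, m) := by
  obtain ⟨h0, -, hpos, hd⟩ := hf
  induction i generalizing m with
  | zero =>
    have h := hd 1 le_rfl hi m
    simp only [Nat.sub_self, h0] at h ⊢
    simp only [Nat.cast_zero, add_zero, zero_add]
    linarith
  | succ i ih =>
    have hrec := ih (by omega) (m + 1)
    have hd₁ := hd (i + 1) (by omega) (by omega) m
    have hd₂ := hd (i + 1 + 1) (by omega) (by omega) m
    simp only [Nat.add_sub_cancel] at hd₁ hd₂
    have hm : m + 1 + (i : ℤ) + 1 = m + ((i + 1 : ℕ) : ℤ) + 1 := by push_cast; ring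
    rw [hm] at hrec
    refine Nat.eq_of_mul_eq_mul_left (hpos (i + 1) (by omega) (by omega) (m + 1)) ?_
    linear_combination hd₁ - hd₂ + f (i + 1 + 1, m) * hrec

/-- A sequence of positive integers that starts and ends with `1`, is not bounded by `1`, and in
which every interior entry divides the sum of its neighbours, has an interior entry that equals the
sum of its neighbours. -/
theorem exists_eq_add_of_dvd_add {n : ℕ} {d : ℕ → ℕ} (h0 : d 0 = 1) (hlast : d (n + 1) = 1)
    (hpos : ∀ i ≤ n + 1, 0 < d i) (hdvd : ∀ i < n, d (i + 1) ∣ d i + d (i + 2))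
    (hone : ∃ i ≤ n + 1, 1 < d i) :
    ∃ j < n, d (j + 1) = d j + d (j + 2) := by
  classical
  obtain ⟨k, hk, hmax⟩ := Finset.exists_max_image (Finset.range (n + 2)) d ⟨0, by simp⟩
  simp only [Finset.mem_range] at hk hmax
  have hex : ∃ j, d j = d k := ⟨k, rfl⟩
  have hspec := Nat.find_spec hex
  have hmin := fun i => Nat.find_min (H := hex) (m := i)
  have hle := Nat.find_min' hex rfl
  generalize Nat.find hex = j at hspec hmin hle
  obtain ⟨i, hi, hi'⟩ := hone
  have hik := hmax i (by omega)
  have hj : j ≠ n + 1 := by rintro rfl; omega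
  obtain _ | j := j
  · omega
  refine ⟨j, by omega, ?_⟩
  have hl := hmax j (by omega)
  have hr := hmax (j + 2) (by omega)
  have hne := hmin j (by omega)
  have hp := hpos j (by omega)
  obtain ⟨c, hc⟩ := hdvd j (by omega)
  have hc2 : c < 2 := by
    by_contra! h
    have := Nat.mul_le_mul_left (d (j + 1)) h
    omega
  interval_cases c <;> omega

/-- Fibonacci bounds for the entries, and for the sums of adjacent entries, of a sequence of positive
integers that starts and ends with `1` and in which every interior entry divides the sum of its
neighbours. -/
theorem le_fib_of_dvd_add (n : ℕ) (d : ℕ → ℕ) (h0 : d 0 = 1) (hlast : d (n + 1) = 1)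
    (hpos : ∀ i ≤ n + 1, 0 < d i) (hdvd : ∀ i < n, d (i + 1) ∣ d i + d (i + 2)) :
    (∀ i ≤ n + 1, d i ≤ Nat.fib (n + 2)) ∧ ∀ i ≤ n, d i + d (i + 1) ≤ Nat.fib (n + 3) := by
  induction n generalizing d with
  | zero =>
    refine ⟨fun i hi => ?_, fun i hi => ?_⟩
    · obtain rfl | rfl : i = 0 ∨ i = 1 := by omega
      all_goals simp [*] at *
    · obtain rfl : i = 0 := by omega
      simp_all [Nat.fib_add_two]
  | succ n ih =>
    have hf₁ : 0 < Nat.fib (n + 2) := Nat.fib_pos.2 (by omega)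
    have hf₂ : Nat.fib (n + 2) ≤ Nat.fib (n + 3) := Nat.fib_le_fib_succ
    have hf₃ : Nat.fib (n + 4) = Nat.fib (n + 2) + Nat.fib (n + 3) := Nat.fib_add_two
    simp only [show n + 1 + 2 = n + 3 from rfl, show n + 1 + 3 = n + 4 from rfl]
    by_cases hone : ∃ i ≤ n + 1 + 1, 1 < d i
    swap
    · push Not at hone
      refine ⟨fun i hi => (hone i hi).trans (by omega), fun i hi => ?_⟩
      have := hone i (by omega)
      have := hone (i + 1) (by omega)
      omega
    obtain ⟨j, hj, hsum⟩ := exists_eq_add_of_dvd_add h0 hlast hpos hdvd hone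
    let e : ℕ → ℕ := fun i => if i ≤ j then d i else d (i + 1)
    have he₁ : ∀ i ≤ j, e i = d i := fun i hi => if_pos hi
    have he₂ : ∀ i, j < i → e i = d (i + 1) := fun i hi => if_neg (by omega)
    obtain ⟨hle, hadd⟩ := ih e (by rw [he₁ 0 (by omega), h0]) (by rw [he₂ _ hj, hlast])
      (fun i hi => by
        rcases le_or_gt i j with h | h
        · rw [he₁ i h]; exact hpos i (by omega)
        · rw [he₂ i h]; exact hpos (i + 1) (by omega))
      (fun i hi => by
        rcases lt_trichotomy (i + 1) j with h | h | h
        · rw [he₁ _ h.le, he₁ i (by omega), he₁ (i + 2) (by omega)]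
          exact hdvd i (by omega)
        · subst h
          rw [he₁ _ le_rfl, he₁ i (by omega), he₂ (i + 2) (by omega)]
          have := hdvd i (by omega)
          rw [hsum, add_left_comm] at this
          exact (Nat.dvd_add_right dvd_rfl).1 this
        · rcases Nat.lt_succ_iff_lt_or_eq.1 h with h | rfl
          · rw [he₂ i h, he₂ _ (by omega), he₂ _ (by omega)]
            exact hdvd (i + 1) (by omega)
          · rw [he₁ j le_rfl, he₂ _ (by omega), he₂ _ (by omega)]
            have := hdvd (j + 1) (by omega)
            rw [hsum, add_right_comm (d j)] at this
            exact (Nat.dvd_add_left dvd_rfl).1 this)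
    have hmid := hadd j (by omega)
    rw [he₁ j le_rfl, he₂ (j + 1) (by omega)] at hmid
    have hold : ∀ i ≤ n + 2, i ≠ j + 1 → d i ≤ Nat.fib (n + 2) := fun i hi hij => by
      rcases le_or_gt i j with h | h
      · rw [← he₁ i h]; exact hle i (by omega)
      · obtain _ | i := i
        · omega
        rw [← he₂ i (by omega)]; exact hle i (by omega)
    have hnew : d (j + 1) ≤ Nat.fib (n + 3) := hsum.trans_le hmid
    refine ⟨fun i hi => ?_, fun i hi => ?_⟩
    · by_cases h : i = j + 1
      · rwa [h]
      · exact (hold i hi h).trans hf₂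
    · by_cases h : i = j + 1
      · subst h
        have := hold (j + 1 + 1) (by omega) (by omega)
        omega
      · have := hold i (by omega) h
        by_cases h' : i = j
        · subst h'
          omega
        · have := hold (i + 1) (by omega) (by omega)
          omega

/-- Every value of a frieze pattern of type `Aₙ` is at most the Fibonacci number
`F (n+2)`. -/
theorem frieze_A_value_le_fib (n : ℕ) (hn : 0 < n) (f : ℕ × ℤ → ℕ)
    (hf : IsFriezeA n f) :
    ∀ i : ℕ, 1 ≤ i → i ≤ n → ∀ m : ℤ, f (i, m) ≤ Nat.fib (n + 2) := by
  obtain ⟨h0, hlast, hpos, _⟩ := id hf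
  intro i _ hi m
  refine (le_fib_of_dvd_add n (fun i => f (i, m)) (h0 m) (hlast m) (fun i hi => ?_)
    (fun i hi => ⟨_, (hf.add_eq_mul hi m).trans (mul_comm _ _)⟩)).1 i (by omega)
  rcases Nat.eq_zero_or_pos i with rfl | hi0
  · simp [h0]
  · rcases hi.lt_or_eq with hlt | rfl
    · exact hpos i hi0 (by omega) m
    · simp [hlast]
end

section
/- For every positive integer n and every frieze pattern f of type C_n, every value of f is bounded above by the Fibonacci number F_{2n+1}; that is, f(i,m) ≤ F_{2n+1} for all i ∈ {1,…,n} and all m ∈ ℤ. -/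
/-- A frieze pattern of type `Cₙ`: a function on `{1,…,n} × ℤ` with positive values,
encoded as `f : ℕ × ℤ → ℕ` with the convention `f (0, m) = 1`, the diamond rule
for `1 ≤ i ≤ n-1`, and the rule `f(n,m)·f(n,m+1) = 1 + f(n-1,m+1)²`. -/
def IsFriezeC (n : ℕ) (f : ℕ × ℤ → ℕ) : Prop :=
  (∀ m : ℤ, f (0, m) = 1) ∧
  (∀ i : ℕ, 1 ≤ i → i ≤ n → ∀ m : ℤ, 0 < f (i, m)) ∧
  (∀ i : ℕ, 1 ≤ i → i ≤ n - 1 → ∀ m : ℤ,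
    f (i, m) * f (i, m + 1) = 1 + f (i + 1, m) * f (i - 1, m + 1)) ∧
  (∀ m : ℤ, f (n, m) * f (n, m + 1) = 1 + f (n - 1, m + 1) ^ 2)

/-- A triangular array of integers satisfying the unimodular rule with positive entries
off the diagonal, that is, a fundamental region of a positive integral frieze. -/
structure UnimodularArray (N : ℕ) (d : ℕ → ℕ → ℤ) : Prop where
  diag : ∀ i, d i i = 0
  succ : ∀ i, i < N → d i (i + 1) = 1
  pos : ∀ i j, i < j → j ≤ N → 0 < d i j
  rule : ∀ i j, i < j → j < N → d i j * d (i + 1) (j + 1) = 1 + d i (j + 1) * d (i + 1) j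

namespace UnimodularArray

variable {N : ℕ} {d : ℕ → ℕ → ℤ}

/-- Three consecutive rows are linearly dependent. -/
theorem row_recurrence (h : UnimodularArray N d) (i c : ℕ) (hc : i + 2 + c ≤ N) :
    d i (i + 2 + c) + d (i + 2) (i + 2 + c) = d i (i + 2) * d (i + 1) (i + 2 + c) := by
  induction c with
  | zero => simp [h.diag, h.succ (i + 1) (by omega)]
  | succ c ih =>
    have ih := ih (by omega)
    have r₁ := h.rule i (i + 2 + c) (by omega) (by omega)
    have r₂ : d (i + 1) (i + 2 + c) * d (i + 2) (i + 2 + c + 1) =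
        1 + d (i + 1) (i + 2 + c + 1) * d (i + 2) (i + 2 + c) :=
      h.rule (i + 1) (i + 2 + c) (by omega) (by omega)
    have hp := h.pos (i + 1) (i + 2 + c) (by omega) (by omega)
    rw [← add_assoc]
    apply mul_left_cancel₀ hp.ne'
    linear_combination r₂ - r₁ + d (i + 1) (i + 2 + c + 1) * ih

/-- Solutions of the three-term recurrence whose coefficients are the entries `d i (i + 2)`. -/
def solution (d : ℕ → ℕ → ℤ) (x y : ℤ) : ℕ → ℤ
  | 0 => x
  | 1 => y
  | i + 2 => d i (i + 2) * solution d x y (i + 1) - solution d x y i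

theorem solution_wronskian (d : ℕ → ℕ → ℤ) (i : ℕ) :
    solution d 1 0 i * solution d 0 1 (i + 1) - solution d 0 1 i * solution d 1 0 (i + 1) = 1 := by
  induction i with
  | zero => simp [solution]
  | succ i ih =>
    simp only [solution]
    linear_combination ih

/-- The entries are the two by two minors of a pair of solutions of the recurrence. -/
theorem eq_minor (h : UnimodularArray N d) (c i : ℕ) (hc : i + c ≤ N) :
    d i (i + c) = solution d 1 0 i * solution d 0 1 (i + c) -
      solution d 0 1 i * solution d 1 0 (i + c) := by
  induction c using Nat.strong_induction_on generalizing i with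
  | _ c ih =>
    match c with
    | 0 => simp [h.diag]; ring
    | 1 => rw [solution_wronskian, h.succ i (by omega)]
    | c + 2 =>
      have e₁ := ih (c + 1) (by omega) (i + 1) (by omega)
      have e₂ := ih c (by omega) (i + 2) (by omega)
      have r := h.row_recurrence i c (by omega)
      rw [show i + 1 + (c + 1) = i + 2 + c by omega] at e₁
      rw [show i + (c + 2) = i + 2 + c by omega]
      have s₁ : solution d 1 0 (i + 2) =
        d i (i + 2) * solution d 1 0 (i + 1) - solution d 1 0 i := rfl
      have s₂ : solution d 0 1 (i + 2) =
        d i (i + 2) * solution d 0 1 (i + 1) - solution d 0 1 i := rfl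
      linear_combination r + d i (i + 2) * e₁ - e₂ -
        solution d 0 1 (i + 2 + c) * s₁ + solution d 1 0 (i + 2 + c) * s₂

theorem plucker (h : UnimodularArray N d) {i j k l : ℕ} (hij : i ≤ j) (hjk : j ≤ k)
    (hkl : k ≤ l) (hl : l ≤ N) :
    d i k * d j l = d i j * d k l + d i l * d j k := by
  have key : ∀ a b, a ≤ b → b ≤ N → d a b = solution d 1 0 a * solution d 0 1 b -
      solution d 0 1 a * solution d 1 0 b := by
    intro a b hab hb
    obtain ⟨c, rfl⟩ := Nat.exists_eq_add_of_le hab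
    exact h.eq_minor c a hb
  rw [key i k (by omega) (by omega), key j l (by omega) hl, key i j hij (by omega),
    key k l hkl hl, key i l (by omega) hl, key j k hjk (by omega)]
  ring

/-- Every non-boundary arc of length one is a side of a triangle with sides of length one. -/
theorem exists_mediant (h : UnimodularArray N d) {s t : ℕ} (hst : s + 1 < t) (ht : t ≤ N)
    (h1 : d s t = 1) : ∃ k, s < k ∧ k < t ∧ d s k = 1 ∧ d k t = 1 := by
  classical
  have hex : ∃ k, s < k ∧ k < t ∧ d k t ≤ d s k := by
    refine ⟨t - 1, by omega, by omega, ?_⟩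
    have e := h.succ (t - 1) (by omega)
    rw [show t - 1 + 1 = t by omega] at e
    have := h.pos s (t - 1) (by omega) (by omega)
    omega
  obtain ⟨hsk, hkt, hle⟩ := Nat.find_spec hex
  have hmin := fun m (hm : m < Nat.find hex) => Nat.find_min hex hm
  generalize Nat.find hex = k at hsk hkt hle hmin
  obtain ⟨m, rfl⟩ : ∃ m, k = m + 1 := ⟨k - 1, by omega⟩
  have hx := h.pos s (m + 1) hsk (by omega)
  have hy := h.pos (m + 1) t hkt ht
  have hlt : d s m < d m t := by
    rcases Nat.lt_or_ge s m with hs | hs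
    · by_contra hcon
      exact hmin m (by omega) ⟨hs, by omega, by omega⟩
    · obtain rfl : s = m := by omega
      rw [h.diag, h1]
      norm_num
  have hx0 : 0 ≤ d s m := by
    rcases Nat.lt_or_ge s m with hs | hs
    · exact (h.pos s m hs (by omega)).le
    · obtain rfl : s = m := by omega
      rw [h.diag]
  have e := h.plucker (i := s) (j := m) (k := m + 1) (l := t)
    (by omega) (by omega) (by omega) ht
  rw [h1, h.succ m (by omega)] at e
  have : d s (m + 1) ≤ 1 := by
    nlinarith [mul_le_mul_of_nonneg_left hle hx0,
      mul_le_mul_of_nonneg_left (Int.add_one_le_of_lt hlt) hx.le]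
  exact ⟨m + 1, hsk, hkt, by omega, by omega⟩

theorem le_fib_combination (h : UnimodularArray N d) (L : ℕ) {s t k : ℕ} (hst : s < t)
    (ht : t ≤ N) (hL : t ≤ s + L + 1) (h1 : d s t = 1) (hsk : s ≤ k) (hkt : k ≤ t) :
    d 0 k ≤ Nat.fib (L + 1) * d 0 s + Nat.fib L * d 0 t ∨
    d 0 k ≤ Nat.fib L * d 0 s + Nat.fib (L + 1) * d 0 t := by
  have nonneg : ∀ j, j ≤ N → 0 ≤ d 0 j := by
    intro j hj
    rcases Nat.eq_zero_or_pos j with rfl | hj0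
    · rw [h.diag]
    · exact (h.pos 0 j hj0 hj).le
  induction L generalizing s t with
  | zero =>
    obtain rfl | rfl : k = s ∨ k = t := by omega
    · left; simp
    · right; simp
  | succ L ih =>
    have hs0 := nonneg s (by omega)
    have ht0 := nonneg t ht
    have hF : (Nat.fib (L + 1 + 1) : ℤ) = Nat.fib L + Nat.fib (L + 1) := by
      rw [Nat.fib_add_two]; push_cast; ring
    have hF1 : (1 : ℤ) ≤ Nat.fib (L + 1) := by exact_mod_cast Nat.fib_pos.2 (by omega)
    have hF0 : (0 : ℤ) ≤ Nat.fib L := by positivity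
    rw [hF]
    by_cases hadj : t = s + 1
    · obtain rfl | rfl : k = s ∨ k = t := by omega
      · left; nlinarith [mul_nonneg hF0 hs0, mul_nonneg (by linarith : (0 : ℤ) ≤ Nat.fib (L + 1)) ht0]
      · right; nlinarith [mul_nonneg hF0 ht0, mul_nonneg (by linarith : (0 : ℤ) ≤ Nat.fib (L + 1)) hs0]
    · obtain ⟨r, hsr, hrt, e₁, e₂⟩ := h.exists_mediant (by omega : s + 1 < t) ht h1
      have p := h.plucker (Nat.zero_le s) hsr.le hrt.le ht
      rw [h1, e₁, e₂] at p
      have hr : d 0 r = d 0 s + d 0 t := by linarith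
      have hFs := mul_nonneg hF0 hs0
      have hFt := mul_nonneg hF0 ht0
      have hGs := mul_nonneg (by linarith : (0 : ℤ) ≤ Nat.fib (L + 1) - 1) hs0
      have hmono : (Nat.fib L : ℤ) ≤ Nat.fib (L + 1) := by exact_mod_cast Nat.fib_le_fib_succ
      have hMs := mul_le_mul_of_nonneg_right hmono hs0
      have hMt := mul_le_mul_of_nonneg_right hmono ht0
      rcases le_total k r with hk | hk
      · left
        rcases ih hsr (by omega) (by omega) e₁ hsk hk with hh | hh <;> rw [hr] at hh <;> nlinarith
      · right
        rcases ih hrt ht (by omega) e₂ hk hkt with hh | hh <;> rw [hr] at hh <;> nlinarith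

theorem le_fib (h : UnimodularArray N d) (hN : 0 < N) (h1 : d 0 N = 1) {k : ℕ} (hk : k ≤ N) :
    d 0 k ≤ Nat.fib N := by
  obtain ⟨L, rfl⟩ : ∃ L, N = L + 1 := ⟨N - 1, by omega⟩
  have hmono : (Nat.fib L : ℤ) ≤ Nat.fib (L + 1) := by exact_mod_cast Nat.fib_le_fib_succ
  rcases h.le_fib_combination L hN le_rfl (by omega) h1 (Nat.zero_le k) hk with hh | hh <;>
    rw [h.diag, h1] at hh <;> linarith

end UnimodularArray

/-- The type `A` frieze of width `2n - 1` obtained by unfolding a frieze of type `Cₙ`. -/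
def unfoldC (n : ℕ) (f : ℕ × ℤ → ℕ) (i : ℕ) (m : ℤ) : ℕ :=
  if i ≤ n then f (i, m) else f (2 * n - i, m + i - n)

theorem unfoldC_of_le {n : ℕ} (f : ℕ × ℤ → ℕ) {i : ℕ} (hi : i ≤ n) (m : ℤ) :
    unfoldC n f i m = f (i, m) := if_pos hi

theorem unfoldC_of_ge {n : ℕ} (f : ℕ × ℤ → ℕ) {i : ℕ} (hi : n ≤ i) (m : ℤ) :
    unfoldC n f i m = f (2 * n - i, m + i - n) := by
  unfold unfoldC
  split_ifs with h
  · obtain rfl : i = n := by omega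
    congr 2
    · omega
    · ring
  · rfl

namespace IsFriezeC

variable {n : ℕ} {f : ℕ × ℤ → ℕ}

theorem pos_of_le (hf : IsFriezeC n f) {i : ℕ} (hi : i ≤ n) (m : ℤ) : 0 < f (i, m) := by
  rcases Nat.eq_zero_or_pos i with rfl | h
  · rw [hf.1]; norm_num
  · exact hf.2.1 i h hi m

theorem unfoldC_pos (hf : IsFriezeC n f) (i : ℕ) (hi : i ≤ 2 * n) (m : ℤ) :
    0 < unfoldC n f i m := by
  unfold unfoldC
  split_ifs with h
  · exact hf.pos_of_le h m
  · exact hf.pos_of_le (by omega) _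

theorem unfoldC_rule (hf : IsFriezeC n f) (i : ℕ) (hi : i + 1 < 2 * n) (m : ℤ) :
    unfoldC n f (i + 1) m * unfoldC n f (i + 1) (m + 1) =
      1 + unfoldC n f (i + 2) m * unfoldC n f i (m + 1) := by
  obtain ⟨-, -, hrule, hlast⟩ := hf
  rcases lt_trichotomy (i + 1) n with h | h | h
  · rw [unfoldC_of_le f (by omega), unfoldC_of_le f (by omega), unfoldC_of_le f (by omega),
      unfoldC_of_le f (by omega)]
    exact hrule (i + 1) (by omega) (by omega) m
  · subst h
    rw [unfoldC_of_le f le_rfl, unfoldC_of_le f le_rfl, unfoldC_of_ge f (by omega),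
      unfoldC_of_le f (by omega), hlast m, sq]
    congr 4
    · omega
    · push_cast; ring
  · obtain ⟨c, hc⟩ : ∃ c, 2 * n = i + 2 + c := ⟨2 * n - (i + 2), by omega⟩
    rw [unfoldC_of_ge f (by omega), unfoldC_of_ge f (by omega), unfoldC_of_ge f (by omega),
      unfoldC_of_ge f (by omega)]
    have e := hrule (c + 1) (by omega) (by omega) (m + (i + 1 : ℕ) - n)
    rw [show 2 * n - (i + 1) = c + 1 by omega, show 2 * n - (i + 2) = c by omega,
      show 2 * n - i = c + 1 + 1 by omega,
      show m + 1 + ((i + 1 : ℕ) : ℤ) - n = m + (i + 1 : ℕ) - n + 1 by ring,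
      show m + ((i + 2 : ℕ) : ℤ) - n = m + (i + 1 : ℕ) - n + 1 by push_cast; ring,
      show m + 1 + (i : ℤ) - n = m + (i + 1 : ℕ) - n by push_cast; ring, e]
    simp only [Nat.add_sub_cancel]
    ring

theorem unimodularArray (hf : IsFriezeC n f) (m : ℤ) :
    UnimodularArray (2 * n + 1)
      (fun i j => if j ≤ i then 0 else (unfoldC n f (j - i - 1) (m + i) : ℤ)) where
  diag i := by simp
  succ i _ := by simp [unfoldC_of_le f (Nat.zero_le n), hf.1]
  pos i j hij hj := by
    rw [if_neg (by omega)]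
    exact_mod_cast hf.unfoldC_pos _ (by omega) _
  rule i j hij hj := by
    obtain ⟨c, rfl⟩ : ∃ c, j = i + 1 + c := ⟨j - (i + 1), by omega⟩
    cases c with
    | zero => simp [unfoldC_of_le f (Nat.zero_le n), hf.1]
    | succ c =>
      rw [if_neg (by omega), if_neg (by omega), if_neg (by omega), if_neg (by omega),
        show i + 1 + (c + 1) - i - 1 = c + 1 by omega,
        show i + 1 + (c + 1) + 1 - (i + 1) - 1 = c + 1 by omega,
        show i + 1 + (c + 1) + 1 - i - 1 = c + 2 by omega,
        show i + 1 + (c + 1) - (i + 1) - 1 = c by omega,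
        show m + ((i + 1 : ℕ) : ℤ) = m + i + 1 by push_cast; ring]
      exact_mod_cast hf.unfoldC_rule c (by omega) (m + i)

end IsFriezeC

/-- Every value of a frieze pattern of type `Cₙ` is at most the Fibonacci number
`F (2n+1)`. -/
theorem frieze_C_value_le_fib (n : ℕ) (hn : 0 < n) (f : ℕ × ℤ → ℕ)
    (hf : IsFriezeC n f) :
    ∀ i : ℕ, 1 ≤ i → i ≤ n → ∀ m : ℤ, f (i, m) ≤ Nat.fib (2 * n + 1) := by
  intro i _ hin m
  have h := (hf.unimodularArray m).le_fib (by omega)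
    (by simp [unfoldC_of_ge f (by omega : n ≤ 2 * n), hf.1]) (k := i + 1) (by omega)
  simpa [unfoldC_of_le f hin] using h
end

section
/- For every positive integer n, there exists a frieze pattern f of type C_n, an index i ∈ {1,…,n} and an integer m such that f(i,m) = F_{2n+1}; combined with the upper bound, the maximum value occurring in frieze patterns of type C_n is exactly the Fibonacci number F_{2n+1}. -/
/-! ### The upper bound -/

/-- A sequence `0, 1, …, 1` of positive integers (after the first) in which every inner term divides
the sum of its neighbours is bounded by Fibonacci numbers. -/
theorem fib_bound_of_dvd_neighbours (L : ℕ) (y : ℕ → ℕ) (h0 : y 0 = 0) (h1 : y 1 = 1)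
    (hL : y (L + 1) = 1) (hpos : ∀ k, 1 ≤ k → k ≤ L + 1 → 0 < y k)
    (hdvd : ∀ k, k < L → y (k + 1) ∣ y k + y (k + 2)) :
    (∀ k, k ≤ L + 1 → y k ≤ Nat.fib (L + 1)) ∧
      (∀ k, k ≤ L → y k + y (k + 1) ≤ Nat.fib (L + 2)) := by
  induction L generalizing y with
  | zero =>
    constructor
    · intro k hk
      interval_cases k <;> simp [h0, h1]
    · intro k hk
      interval_cases k
      simp [h0, h1]
  | succ L ih =>
    change y (L + 2) = 1 at hL
    by_cases hone : ∀ k, k ≤ L + 2 → y k ≤ 1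
    · have hf : 0 < Nat.fib (L + 1) := Nat.fib_pos.2 (by omega)
      have hf' : 0 < Nat.fib (L + 2) := Nat.fib_pos.2 (by omega)
      have e3 : Nat.fib (L + 1 + 2) = Nat.fib (L + 1) + Nat.fib (L + 2) := Nat.fib_add_two
      refine ⟨fun k hk => (hone k hk).trans hf', fun k hk => ?_⟩
      have := hone k (by omega)
      have := hone (k + 1) (by omega)
      omega
    · push Not at hone
      obtain ⟨k₀, hk₀, hy₀⟩ := hone
      -- the first position of the maximum is an ear
      obtain ⟨M, hM, hMmax⟩ := Finset.exists_max_image (Finset.range (L + 3)) y ⟨0, by simp⟩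
      have hex : ∃ k, k ≤ L + 2 ∧ y k = y M := ⟨M, by simpa [Nat.lt_succ_iff] using hM, rfl⟩
      have hmax : ∀ j, j ≤ L + 2 → y j ≤ y M := fun j hj => hMmax j (by simp; omega)
      classical
      obtain ⟨hkle, hky⟩ := Nat.find_spec hex
      have hmin : ∀ j, j < Nat.find hex → y j < y M := fun j hj => by
        have := Nat.find_min hex hj
        have h2 := hmax j (by omega)
        by_contra hc
        exact this ⟨by omega, by omega⟩
      generalize Nat.find hex = k at hkle hky hmin
      have hbig : 1 < y k := by have := hmax k₀ hk₀; omega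
      have hk0 : k ≠ 0 := by rintro rfl; omega
      have hk1 : k ≠ 1 := by rintro rfl; omega
      have hkL : k ≠ L + 2 := by rintro rfl; omega
      obtain ⟨p, rfl⟩ : ∃ p, k = p + 2 := ⟨k - 2, by omega⟩
      have hsum : y (p + 1) + y (p + 3) = y (p + 2) := by
        obtain ⟨c, hc⟩ := hdvd (p + 1) (by omega)
        have a1 := hmin (p + 1) (by omega)
        have a2 := hmax (p + 3) (by omega)
        have a3 := hpos (p + 1) (by omega) (by omega)
        rw [show p + 1 + 2 = p + 3 from rfl, show p + 1 + 1 = p + 2 from rfl] at hc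
        have hc2 : c < 2 := by
          by_contra hcon
          have : y (p + 2) * 2 ≤ y (p + 2) * c := Nat.mul_le_mul_left _ (by omega)
          omega
        interval_cases c <;> omega
      set z : ℕ → ℕ := fun j => if j < p + 2 then y j else y (j + 1) with hz
      have zlt : ∀ j, j < p + 2 → z j = y j := fun j hj => by simp [hz, hj]
      have zge : ∀ j, p + 2 ≤ j → z j = y (j + 1) := fun j hj => by
        simp [hz, Nat.not_lt.2 hj]
      obtain ⟨b1, b2⟩ := ih z (by rw [zlt _ (by omega), h0]) (by rw [zlt _ (by omega), h1])
        (by rw [zge _ (by omega), hL])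
        (fun j hj hj' => by
          by_cases h : j < p + 2
          · rw [zlt _ h]; exact hpos _ hj (by omega)
          · rw [zge _ (by omega)]; exact hpos _ (by omega) (by omega))
        (fun j hj => by
          rcases lt_trichotomy j p with h | rfl | h
          · rw [zlt _ (by omega), zlt _ (by omega), zlt _ (by omega)]
            exact hdvd j (by omega)
          · rw [zlt _ (by omega), zlt _ (by omega), zge _ (by omega)]
            have := hdvd j (by omega)
            rw [← hsum, add_comm (y (j + 1)), ← add_assoc] at this
            exact (Nat.dvd_add_left (dvd_refl _)).1 this
          · obtain rfl | h := eq_or_lt_of_le (show p + 1 ≤ j from h)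
            · rw [zge (p + 1 + 1) (by omega), zlt (p + 1) (by omega), zge (p + 1 + 2) (by omega)]
              have := hdvd (p + 2) (by omega)
              rw [← hsum, add_right_comm (y (p + 1))] at this
              exact (Nat.dvd_add_left (dvd_refl _)).1 this
            · rw [zge _ (by omega), zge _ (by omega), zge _ (by omega)]
              exact hdvd (j + 1) (by omega))
      have c1 : ∀ j, j ≤ L + 2 → j ≠ p + 2 → y j ≤ Nat.fib (L + 1) := fun j hj hne => by
        by_cases h : j < p + 2
        · rw [← zlt _ h]; exact b1 _ (by omega)
        · obtain ⟨i, rfl⟩ : ∃ i, j = i + 1 := ⟨j - 1, by omega⟩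
          rw [← zge _ (by omega)]; exact b1 _ (by omega)
      have c2 : y (p + 1) + y (p + 3) ≤ Nat.fib (L + 2) := by
        have := b2 (p + 1) (by omega)
        rwa [zlt _ (by omega), zge _ (by omega)] at this
      have e3 : Nat.fib (L + 1 + 2) = Nat.fib (L + 1) + Nat.fib (L + 2) := Nat.fib_add_two
      have mono : Nat.fib (L + 1) ≤ Nat.fib (L + 2) := Nat.fib_mono (by omega)
      have d1 := c1 (p + 1) (by omega) (by omega)
      have d3 := c1 (p + 3) (by omega) (by omega)
      refine ⟨fun j hj => ?_, fun j hj => ?_⟩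
      · by_cases h : j = p + 2
        · subst h; rw [← hsum]; exact c2
        · exact (c1 j hj h).trans mono
      · by_cases h : j = p + 2
        · subst h; rw [show p + 2 + 1 = p + 3 from rfl]; omega
        · by_cases h' : j = p + 1
          · subst h'; rw [show p + 1 + 1 = p + 2 from rfl]; omega
          · by_cases h2 : j < p + 2
            · have := b2 j (by omega)
              rw [zlt _ h2, zlt _ (by omega)] at this
              omega
            · obtain ⟨i, rfl⟩ : ∃ i, j = i + 1 := ⟨j - 1, by omega⟩
              have := b2 i (by omega)
              rw [zge _ (by omega), zge _ (by omega)] at this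
              omega

/-- The three-term recurrence along the diagonals of an array satisfying the diamond rule. -/
theorem recurrence_of_diamond (L : ℕ) (y : ℕ → ℤ → ℕ) (h0 : ∀ m, y 0 m = 0) (h1 : ∀ m, y 1 m = 1)
    (hpos : ∀ k, 1 ≤ k → k ≤ L + 1 → ∀ m, 0 < y k m)
    (hd : ∀ k, k < L → ∀ m, y (k + 1) m * y (k + 1) (m + 1) = 1 + y (k + 2) m * y k (m + 1))
    (k : ℕ) (hk : k < L) (m : ℤ) :
    y k m + y (k + 2) m = y (k + 1) m * y 2 (m + k) := by
  induction k generalizing m with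
  | zero => simp [h0, h1]
  | succ k ih =>
    have i1 := ih (by omega) (m + 1)
    have e1 := hd k (by omega) m
    have e2 := hd (k + 1) hk m
    have p1 := hpos (k + 1) (by omega) (by omega) (m + 1)
    refine Nat.eq_of_mul_eq_mul_left p1 ?_
    rw [show m + 1 + (k : ℤ) = m + ((k + 1 : ℕ) : ℤ) by push_cast; ring] at i1
    simp only [show k + 1 + 1 = k + 2 from rfl, show k + 1 + 2 = k + 3 from rfl] at *
    zify at *
    linear_combination e1 - e2 + (y (k + 2) m : ℤ) * i1

/-- The symmetric extension of a frieze of type `Cₙ` to one of type `A₂ₙ₋₁`, with the row of zeros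
above it. -/
def friezeExtension (n : ℕ) (f : ℕ × ℤ → ℕ) (k : ℕ) (m : ℤ) : ℕ :=
  if k = 0 then 0
  else if k ≤ n + 1 then f (k - 1, m) else f (2 * n + 1 - k, m + (k : ℤ) - (n + 1))

namespace IsFriezeC

variable {n : ℕ} {f : ℕ × ℤ → ℕ}

theorem friezeExtension_diamond (hn : 0 < n) (hf : IsFriezeC n f) (k : ℕ) (hk : k < 2 * n) (m : ℤ) :
    friezeExtension n f (k + 1) m * friezeExtension n f (k + 1) (m + 1) =
      1 + friezeExtension n f (k + 2) m * friezeExtension n f k (m + 1) := by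
  obtain ⟨h0, -, hd, hl⟩ := hf
  have lo : ∀ j m, j ≤ n → friezeExtension n f (j + 1) m = f (j, m) := fun j m hj => by
    simp [friezeExtension, hj]
  have hi : ∀ j m, j ≤ n → friezeExtension n f (2 * n + 1 - j) m = f (j, m + n - j) :=
    fun j m hj => by
      obtain rfl | hj := eq_or_lt_of_le hj
      · rw [show 2 * j + 1 - j = j + 1 by omega, lo _ _ le_rfl]; simp
      · unfold friezeExtension
        rw [if_neg (by omega), if_neg (by omega), show 2 * n + 1 - (2 * n + 1 - j) = j by omega]
        congr 2
        push_cast [show j ≤ 2 * n + 1 by omega]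
        ring
  rcases lt_trichotomy k n with h | rfl | h
  · rcases k with _ | k
    · rw [lo _ _ (by omega), lo _ _ (by omega), h0, h0]; simp [friezeExtension]
    · rw [lo _ _ (by omega), lo _ _ (by omega), lo _ _ (by omega), lo _ _ (by omega)]
      exact hd (k + 1) (by omega) (by omega) m
  · obtain ⟨p, rfl⟩ : ∃ p, k = p + 1 := ⟨k - 1, by omega⟩
    have e := hi p m (by omega)
    rw [show 2 * (p + 1) + 1 - p = p + 1 + 2 by omega,
      show m + ((p + 1 : ℕ) : ℤ) - p = m + 1 by push_cast; ring] at e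
    rw [e, lo _ _ le_rfl, lo _ _ le_rfl, lo _ _ (by omega), hl m]
    simp [sq]
  · obtain ⟨j, hj⟩ : ∃ j, k + j + 2 = 2 * n + 1 := ⟨2 * n - 1 - k, by omega⟩
    have e0 := hi j m (by omega)
    have e1 := hi (j + 1) m (by omega)
    have e1' := hi (j + 1) (m + 1) (by omega)
    have e2 := hi (j + 2) (m + 1) (by omega)
    rw [show 2 * n + 1 - j = k + 2 by omega] at e0
    rw [show 2 * n + 1 - (j + 1) = k + 1 by omega] at e1 e1'
    rw [show 2 * n + 1 - (j + 2) = k by omega] at e2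
    have := hd (j + 1) (by omega) (by omega) (m + n - (j + 1 : ℕ))
    rw [e0, e1, e1', e2, show m + 1 + (n : ℤ) - (j + 1 : ℕ) = m + n - (j + 1 : ℕ) + 1 by ring, this,
      show m + 1 + (n : ℤ) - (j + 2 : ℕ) = m + n - (j + 1 : ℕ) by push_cast; ring,
      show m + (n : ℤ) - j = m + n - (j + 1 : ℕ) + 1 by push_cast; ring, mul_comm (f (j, _))]
    rfl

theorem le_fib (hn : 0 < n) (hf : IsFriezeC n f) (i : ℕ) (hi : i ≤ n) (m : ℤ) :
    f (i, m) ≤ Nat.fib (2 * n + 1) := by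
  have hpos : ∀ j, j ≤ n → ∀ m, 0 < f (j, m) := fun j hj m => by
    rcases Nat.eq_zero_or_pos j with rfl | h
    · rw [hf.1]; exact one_pos
    · exact hf.2.1 j h hj m
  have hy1 : ∀ m, friezeExtension n f 1 m = 1 := fun m => by simp [friezeExtension, hf.1]
  have hypos : ∀ k, 1 ≤ k → k ≤ 2 * n + 1 → ∀ m, 0 < friezeExtension n f k m := by
    intro k h1 h2 m
    unfold friezeExtension
    split_ifs
    · omega
    · exact hpos _ (by omega) _
    · exact hpos _ (by omega) _
  have key := (fib_bound_of_dvd_neighbours (2 * n) (fun k => friezeExtension n f k m)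
    (by simp [friezeExtension]) (hy1 m)
    (by
      have : ¬ (2 * n + 1 ≤ n + 1) := by omega
      simp only [friezeExtension, if_neg this, Nat.sub_self, hf.1]
      simp)
    (fun k h1 h2 => hypos k h1 h2 m)
    (fun k hk => ⟨_, recurrence_of_diamond (2 * n) (friezeExtension n f)
      (fun m => by simp [friezeExtension]) hy1 hypos
      (fun k hk m => hf.friezeExtension_diamond hn k hk m) k hk m⟩)).1 (i + 1) (by omega)
  simpa [friezeExtension, hi] using key

end IsFriezeC

/-! ### A frieze attaining the bound -/

/-- The determinant of two planar vectors. -/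
def planeCross (v w : Fin 2 → ℤ) : ℤ := v 0 * w 1 - v 1 * w 0

theorem planeCross_mulVec (g : Matrix.SpecialLinearGroup (Fin 2) ℤ) (v w : Fin 2 → ℤ) :
    planeCross (g.1.mulVec v) (g.1.mulVec w) = planeCross v w := by
  have h := g.2
  rw [Matrix.det_fin_two] at h
  simp only [planeCross, Matrix.mulVec, dotProduct, Fin.sum_univ_two]
  linear_combination (v 0 * w 1 - v 1 * w 0) * h

theorem planeCross_plucker (a b c d : Fin 2 → ℤ) :
    planeCross a c * planeCross b d =
      planeCross a b * planeCross c d + planeCross a d * planeCross b c := by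
  simp only [planeCross]
  ring

/-- A bi-infinite sequence of vectors with consecutive determinants `1`, positive determinants at
distance at most `n + 1`, and the symmetry of a half turn of the polygon with `2 * n + 2` vertices,
yields a frieze of type `Cₙ`. -/
theorem isFriezeC_of_vectors (n : ℕ) (hn : 0 < n) (V : ℤ → Fin 2 → ℤ)
    (hone : ∀ m, planeCross (V m) (V (m + 1)) = 1)
    (hpos : ∀ m, ∀ j : ℕ, 1 ≤ j → j ≤ n + 1 → 0 < planeCross (V m) (V (m + j)))
    (hsymm : ∀ m, planeCross (V m) (V (m + n + 2)) = planeCross (V (m + 1)) (V (m + n + 1))) :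
    IsFriezeC n (fun p => (planeCross (V p.2) (V (p.2 + p.1 + 1))).toNat) := by
  have hp : ∀ m, ∀ i : ℕ, i ≤ n → 0 < planeCross (V m) (V (m + i + 1)) := fun m i hi => by
    have := hpos m (i + 1) (by omega) (by omega)
    rwa [Nat.cast_succ, ← add_assoc] at this
  have hdiamond : ∀ m, ∀ i : ℕ, 1 ≤ i →
      planeCross (V m) (V (m + i + 1)) * planeCross (V (m + 1)) (V (m + 1 + i + 1)) =
        1 + planeCross (V m) (V (m + (i + 1 : ℕ) + 1)) *
          planeCross (V (m + 1)) (V (m + 1 + (i - 1 : ℕ) + 1)) := fun m i hi => by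
    have := planeCross_plucker (V m) (V (m + 1)) (V (m + i + 1)) (V (m + i + 1 + 1))
    rw [hone, hone] at this
    rw [show m + 1 + (i : ℤ) + 1 = m + i + 1 + 1 by ring, this]
    push_cast [hi]
    rw [show m + ((i : ℤ) + 1) + 1 = m + i + 1 + 1 by ring,
      show m + 1 + ((i : ℤ) - 1) + 1 = m + i + 1 by ring]
  refine ⟨fun m => ?_, fun i _ hi m => ?_, fun i h1 hi m => ?_, fun m => ?_⟩
  · simp [hone]
  · simpa using hp m i hi
  · have := hdiamond m i h1
    have a1 := hp m i (by omega)
    have a2 := hp (m + 1) i (by omega)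
    have a3 := hp m (i + 1) (by omega)
    have a4 := hp (m + 1) (i - 1) (by omega)
    rw [Nat.cast_succ] at a3 this
    zify
    simp only [Int.toNat_of_nonneg a1.le, Int.toNat_of_nonneg a2.le, Int.toNat_of_nonneg a3.le,
      Int.toNat_of_nonneg a4.le]
    exact this
  · have := hdiamond m n hn
    have a1 := hp m n le_rfl
    have a2 := hp (m + 1) n le_rfl
    have a4 := hp (m + 1) (n - 1) (by omega)
    zify
    simp only [Int.toNat_of_nonneg a1.le, Int.toNat_of_nonneg a2.le, Int.toNat_of_nonneg a4.le]
    rw [this, show m + ((n + 1 : ℕ) : ℤ) + 1 = m + n + 2 by push_cast; ring, hsymm,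
      show m + 1 + ((n - 1 : ℕ) : ℤ) + 1 = m + n + 1 by push_cast [hn]; ring]
    ring

theorem fib_cross_even (s c : ℕ) :
    (Nat.fib (2 * s + 1) * Nat.fib (2 * s + c) - Nat.fib (2 * s) * Nat.fib (2 * s + c + 1) : ℤ) =
      Nat.fib c := by
  induction s with
  | zero => simp
  | succ s ih =>
    have e1 : Nat.fib (2 * s + 2) = Nat.fib (2 * s) + Nat.fib (2 * s + 1) := Nat.fib_add_two
    have e2 : Nat.fib (2 * s + 3) = Nat.fib (2 * s + 1) + Nat.fib (2 * s + 2) := Nat.fib_add_two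
    have e3 : Nat.fib (2 * s + c + 2) = Nat.fib (2 * s + c) + Nat.fib (2 * s + c + 1) :=
      Nat.fib_add_two
    have e4 : Nat.fib (2 * s + c + 3) = Nat.fib (2 * s + c + 1) + Nat.fib (2 * s + c + 2) :=
      Nat.fib_add_two
    rw [show 2 * (s + 1) + 1 = 2 * s + 3 by ring, show 2 * (s + 1) + c + 1 = 2 * s + c + 3 by ring,
      show 2 * (s + 1) + c = 2 * s + c + 2 by ring, show 2 * (s + 1) = 2 * s + 2 by ring,
      e4, e3, e2, e1]
    push_cast
    linear_combination ih

theorem fib_cross_even_odd_pos (r t : ℕ) :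
    (0 : ℤ) < Nat.fib (2 * r + 1) * Nat.fib (2 * t + 1) - Nat.fib (2 * r) * Nat.fib (2 * t + 2) := by
  rcases le_total r t with h | h
  · obtain ⟨c, rfl⟩ := Nat.exists_eq_add_of_le h
    have := fib_cross_even r (2 * c + 1)
    rw [show 2 * r + (2 * c + 1) + 1 = 2 * (r + c) + 2 by ring,
      show 2 * r + (2 * c + 1) = 2 * (r + c) + 1 by ring] at this
    rw [this]
    exact_mod_cast Nat.fib_pos.2 (by omega)
  · obtain ⟨c, rfl⟩ := Nat.exists_eq_add_of_le h
    rcases c with _ | c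
    · have := fib_cross_even t 1
      rw [show 2 * t + 1 + 1 = 2 * t + 2 by ring] at this
      rw [add_zero, this]
      simp
    · have e0 := fib_cross_even t (2 * c + 1)
      have e1 : Nat.fib (2 * t + 2) = Nat.fib (2 * t) + Nat.fib (2 * t + 1) := Nat.fib_add_two
      have e2 : Nat.fib (2 * t + 2 * c + 3) =
        Nat.fib (2 * t + 2 * c + 1) + Nat.fib (2 * t + 2 * c + 2) := Nat.fib_add_two
      have hp : (0 : ℤ) < Nat.fib (2 * c + 1) := by exact_mod_cast Nat.fib_pos.2 (by omega)
      rw [show 2 * t + (2 * c + 1) + 1 = 2 * t + 2 * c + 2 by ring,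
        show 2 * t + (2 * c + 1) = 2 * t + 2 * c + 1 by ring] at e0
      rw [show 2 * (t + (c + 1)) + 1 = 2 * t + 2 * c + 3 by ring,
        show 2 * (t + (c + 1)) = 2 * t + 2 * c + 2 by ring, e1, e2]
      push_cast
      linarith

/-- The vectors at the vertices of half of a zigzag triangulation of a polygon. -/
def zigzagVector : ℕ → Fin 2 → ℤ
  | 0 => ![0, -1]
  | k + 1 => ![Nat.fib (2 * k + 1), Nat.fib (2 * k)]

theorem planeCross_zigzagVector_pos (r s : ℕ) (h : r < s) :
    0 < planeCross (zigzagVector r) (zigzagVector s) := by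
  obtain ⟨s, rfl⟩ : ∃ t, s = t + 1 := ⟨s - 1, by omega⟩
  rcases r with _ | r
  · simp [planeCross, zigzagVector, Nat.fib_pos]
  · obtain ⟨c, rfl⟩ := Nat.exists_eq_add_of_le (show r + 1 ≤ s by omega)
    have := fib_cross_even r (2 * c + 2)
    rw [show 2 * r + (2 * c + 2) + 1 = 2 * (r + 1 + c) + 1 by ring,
      show 2 * r + (2 * c + 2) = 2 * (r + 1 + c) by ring] at this
    simp only [planeCross, zigzagVector, Matrix.cons_val_zero, Matrix.cons_val_one]
    rw [this]
    exact_mod_cast Nat.fib_pos.2 (by omega)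

theorem planeCross_zigzagVector_succ (r : ℕ) :
    planeCross (zigzagVector r) (zigzagVector (r + 1)) = 1 := by
  rcases r with _ | r
  · simp [planeCross, zigzagVector]
  · have := fib_cross_even r 2
    simpa [planeCross, zigzagVector, mul_add] using this

/-- The half turn of the zigzag triangulation of the polygon with `2 * p + 4` vertices. -/
def zigzagHalfTurn (p : ℕ) : Matrix.SpecialLinearGroup (Fin 2) ℤ :=
  ⟨!![(Nat.fib (2 * p + 2) : ℤ), -Nat.fib (2 * p + 3); Nat.fib (2 * p + 1), -Nat.fib (2 * p + 2)], by
    have h := fib_cross_even p 2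
    have e1 : Nat.fib (2 * p + 2) = Nat.fib (2 * p) + Nat.fib (2 * p + 1) := Nat.fib_add_two
    have e2 : Nat.fib (2 * p + 3) = Nat.fib (2 * p + 1) + Nat.fib (2 * p + 2) := Nat.fib_add_two
    rw [Matrix.det_fin_two_of]
    simp only [show 2 * p + 2 + 1 = 2 * p + 3 from rfl, Nat.fib_two, e2, e1] at h ⊢
    push_cast at h ⊢
    linear_combination h⟩

theorem zigzagHalfTurn_mulVec_mulVec (p : ℕ) (v : Fin 2 → ℤ) :
    (zigzagHalfTurn p).1.mulVec ((zigzagHalfTurn p).1.mulVec v) = -v := by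
  have h := (zigzagHalfTurn p).2
  rw [Matrix.det_fin_two] at h
  simp only [zigzagHalfTurn, Matrix.of_apply, Matrix.cons_val', Matrix.cons_val_zero,
    Matrix.cons_val_one, Matrix.cons_val_fin_one] at h
  ext i
  fin_cases i
  · simp [zigzagHalfTurn, Matrix.mulVec, dotProduct, Fin.sum_univ_two]
    linear_combination -v 0 * h
  · simp [zigzagHalfTurn, Matrix.mulVec, dotProduct, Fin.sum_univ_two]
    linear_combination -v 1 * h

theorem zigzagHalfTurn_mulVec_zero (p : ℕ) :
    (zigzagHalfTurn p).1.mulVec (zigzagVector 0) = zigzagVector (p + 2) := by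
  ext i
  fin_cases i <;> simp [zigzagHalfTurn, zigzagVector, Matrix.mulVec, dotProduct, Fin.sum_univ_two,
    mul_add]

theorem zigzagHalfTurn_mulVec_succ (s t : ℕ) :
    (zigzagHalfTurn (s + t)).1.mulVec (zigzagVector (s + 1)) =
      ![(Nat.fib (2 * t + 2) : ℤ), Nat.fib (2 * t + 1)] := by
  have h1 := fib_cross_even s (2 * t + 2)
  have h2 := fib_cross_even s (2 * t + 1)
  rw [show 2 * s + (2 * t + 2) + 1 = 2 * (s + t) + 3 by ring,
    show 2 * s + (2 * t + 2) = 2 * (s + t) + 2 by ring] at h1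
  rw [show 2 * s + (2 * t + 1) + 1 = 2 * (s + t) + 2 by ring,
    show 2 * s + (2 * t + 1) = 2 * (s + t) + 1 by ring] at h2
  ext i
  fin_cases i
  · simp [zigzagHalfTurn, zigzagVector, Matrix.mulVec, dotProduct, Fin.sum_univ_two]
    linear_combination h1
  · simp [zigzagHalfTurn, zigzagVector, Matrix.mulVec, dotProduct, Fin.sum_univ_two]
    linear_combination h2

/-- The vectors at all vertices of the zigzag triangulation, indexed by the integers. -/
def zigzagSequence (p : ℕ) (m : ℤ) : Fin 2 → ℤ :=
  (zigzagHalfTurn p ^ (m / (p + 2))).1.mulVec (zigzagVector (m % (p + 2)).toNat)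

theorem zigzagSequence_add_mul (p : ℕ) (m q : ℤ) :
    zigzagSequence p (m + q * (p + 2)) =
      (zigzagHalfTurn p ^ q).1.mulVec (zigzagSequence p m) := by
  have h : (p + 2 : ℤ) ≠ 0 := by positivity
  rw [zigzagSequence, zigzagSequence, Int.add_mul_ediv_right _ _ h, Int.add_mul_emod_self_right,
    Matrix.mulVec_mulVec, add_comm, zpow_add]
  rfl

theorem zigzagSequence_add (p : ℕ) (m : ℤ) :
    zigzagSequence p (m + (p + 2)) = (zigzagHalfTurn p).1.mulVec (zigzagSequence p m) := by
  simpa using zigzagSequence_add_mul p m 1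

theorem zigzagSequence_natCast (p r : ℕ) (hr : r ≤ p + 2) :
    zigzagSequence p r = zigzagVector r := by
  obtain rfl | h := eq_or_lt_of_le hr
  · have := zigzagSequence_add p 0
    rw [zero_add] at this
    push_cast
    rw [this, ← zigzagHalfTurn_mulVec_zero]
    simp [zigzagSequence]
  · have h1 : (r : ℤ) / (p + 2) = 0 := Int.ediv_eq_zero_of_lt (by positivity) (by exact_mod_cast h)
    have h2 : (r : ℤ) % (p + 2) = r := Int.emod_eq_of_lt (by positivity) (by exact_mod_cast h)
    simp [zigzagSequence, h1, h2]

theorem planeCross_zigzagSequence_reduce (p : ℕ) (m : ℤ) :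
    ∃ r : ℕ, r ≤ p + 1 ∧ ∀ j : ℤ, planeCross (zigzagSequence p m) (zigzagSequence p (m + j)) =
      planeCross (zigzagVector r) (zigzagSequence p (r + j)) := by
  have hp : (0 : ℤ) < p + 2 := by positivity
  have a1 := Int.emod_nonneg m hp.ne'
  have a2 := Int.emod_lt_of_pos m hp
  obtain ⟨r, hr⟩ := Int.eq_ofNat_of_zero_le a1
  refine ⟨r, by omega, fun j => ?_⟩
  have hm : m = r + m / (p + 2) * (p + 2) := by
    rw [← hr]; exact (Int.emod_add_ediv_mul m _).symm
  generalize m / (p + 2 : ℤ) = q at hm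
  rw [hm, add_right_comm, zigzagSequence_add_mul, zigzagSequence_add_mul, planeCross_mulVec,
    zigzagSequence_natCast p r (by omega)]

theorem planeCross_zigzagSequence_succ (p : ℕ) (m : ℤ) :
    planeCross (zigzagSequence p m) (zigzagSequence p (m + 1)) = 1 := by
  obtain ⟨r, hr, h⟩ := planeCross_zigzagSequence_reduce p m
  rw [h, ← Nat.cast_succ, zigzagSequence_natCast _ _ (by omega), planeCross_zigzagVector_succ]

theorem planeCross_zigzagSequence_pos (p : ℕ) (m : ℤ) (j : ℕ) (h1 : 1 ≤ j) (hj : j ≤ p + 2) :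
    0 < planeCross (zigzagSequence p m) (zigzagSequence p (m + j)) := by
  obtain ⟨r, hr, h⟩ := planeCross_zigzagSequence_reduce p m
  rw [h]
  by_cases hrj : r + j ≤ p + 2
  · rw [← Nat.cast_add, zigzagSequence_natCast _ _ hrj]
    exact planeCross_zigzagVector_pos _ _ (by omega)
  · obtain ⟨s, hs⟩ : ∃ s, r + j = s + 1 + (p + 2) := ⟨r + j - (p + 3), by omega⟩
    obtain ⟨t, rfl⟩ := Nat.exists_eq_add_of_le (show s ≤ p by omega)
    obtain ⟨r, rfl⟩ : ∃ r', r = r' + 1 := ⟨r - 1, by omega⟩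
    have hs' : ((r + 1 : ℕ) : ℤ) + j = ((s + 1 : ℕ) : ℤ) + ((s + t : ℕ) + 2) := by
      exact_mod_cast hs
    rw [hs', zigzagSequence_add, zigzagSequence_natCast _ _ (by omega),
      zigzagHalfTurn_mulVec_succ]
    simpa [planeCross, zigzagVector] using fib_cross_even_odd_pos r t

theorem planeCross_zigzagSequence_symm (p : ℕ) (m : ℤ) :
    planeCross (zigzagSequence p m) (zigzagSequence p (m + 1 + (p + 2))) =
      planeCross (zigzagSequence p (m + 1)) (zigzagSequence p (m + (p + 2))) := by
  rw [zigzagSequence_add, zigzagSequence_add, ← planeCross_mulVec (zigzagHalfTurn p),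
    zigzagHalfTurn_mulVec_mulVec]
  simp only [planeCross, Pi.neg_apply]
  ring

theorem exists_isFriezeC_eq_fib (n : ℕ) (hn : 0 < n) :
    ∃ f : ℕ × ℤ → ℕ, IsFriezeC n f ∧ f (n, 0) = Nat.fib (2 * n + 1) := by
  obtain ⟨p, rfl⟩ : ∃ p, n = p + 1 := ⟨n - 1, by omega⟩
  refine ⟨_, isFriezeC_of_vectors (p + 1) hn (zigzagSequence p) (planeCross_zigzagSequence_succ p)
    (planeCross_zigzagSequence_pos p) (fun m => ?_), ?_⟩
  · have := planeCross_zigzagSequence_symm p m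
    push_cast
    rwa [show m + ((p : ℤ) + 1) + 2 = m + 1 + (p + 2) by ring,
      show m + ((p : ℤ) + 1) + 1 = m + (p + 2) by ring]
  · have h0 := zigzagSequence_natCast p 0 (by omega)
    have h1 := zigzagSequence_natCast p (p + 2) le_rfl
    dsimp only
    rw [show (0 : ℤ) + ((p + 1 : ℕ) : ℤ) + 1 = ((p + 2 : ℕ) : ℤ) by push_cast; ring, h1,
      ← Nat.cast_zero, h0]
    simp [planeCross, zigzagVector]

/-- The maximum value occurring in frieze patterns of type `Cₙ` is exactly the
Fibonacci number `F (2n+1)`: every value is at most `F (2n+1)`, and some frieze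
pattern of type `Cₙ` attains the value `F (2n+1)`. -/
theorem frieze_C_max_eq_fib (n : ℕ) (hn : 0 < n) :
    (∀ f : ℕ × ℤ → ℕ, IsFriezeC n f →
      ∀ i : ℕ, 1 ≤ i → i ≤ n → ∀ m : ℤ, f (i, m) ≤ Nat.fib (2 * n + 1)) ∧
    (∃ f : ℕ × ℤ → ℕ, IsFriezeC n f ∧
      ∃ i : ℕ, 1 ≤ i ∧ i ≤ n ∧ ∃ m : ℤ, f (i, m) = Nat.fib (2 * n + 1)) := by
  refine ⟨fun f hf i _ hi m => hf.le_fib hn i hi m, ?_⟩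
  obtain ⟨f, hf, h⟩ := exists_isFriezeC_eq_fib n hn
  exact ⟨f, hf, n, hn, le_rfl, 0, h⟩
end

section
/- Let n be a positive integer. An n-tuple (a_1,…,a_n) of positive integers is a diagonal of a frieze pattern of type A_n (i.e., there exist a frieze pattern f of type A_n and an integer m with a_i = f(i,m) for all i ∈ {1,…,n}) if and only if for all i ∈ {1,…,n}, a_i divides a_{i-1} + a_{i+1}, where by convention a_0 = a_{n+1} = 1. -/
/-- A tuple with boundary values `1` whose entries are positive and divide the sum of their
neighbours. -/
structure IsDivisibleTuple (n : ℕ) (a : ℕ → ℕ) : Prop where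
  zero : a 0 = 1
  last : a (n + 1) = 1
  pos : ∀ i < n, 0 < a (i + 1)
  dvd : ∀ i < n, a (i + 1) ∣ a i + a (i + 2)

/-- The diamond rule between two consecutive diagonals. -/
def DiamondRule (n : ℕ) (a b : ℕ → ℕ) : Prop :=
  ∀ i < n, a (i + 1) * b (i + 1) = 1 + a (i + 2) * b i

/-- The tuple read backwards. -/
def reverseTuple (n : ℕ) (a : ℕ → ℕ) (i : ℕ) : ℕ := a (n + 1 - i)

theorem DiamondRule.reverse {n : ℕ} {a b : ℕ → ℕ} (h : DiamondRule n a b) :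
    DiamondRule n (reverseTuple n b) (reverseTuple n a) := by
  intro i hi
  obtain ⟨k, rfl⟩ := Nat.exists_eq_add_of_lt hi
  have := h k (by omega)
  simp only [reverseTuple]
  rw [show i + k + 1 + 1 - (i + 1) = k + 1 by omega, show i + k + 1 + 1 - (i + 2) = k by omega,
    show i + k + 1 + 1 - i = k + 2 by omega]
  linarith

theorem IsDivisibleTuple.reverse {n : ℕ} {a : ℕ → ℕ} (h : IsDivisibleTuple n a) :
    IsDivisibleTuple n (reverseTuple n a) where
  zero := h.last
  last := by simpa [reverseTuple] using h.zero
  pos i hi := by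
    have := h.pos (n - 1 - i) (by omega)
    rwa [show n - 1 - i + 1 = n + 1 - (i + 1) by omega] at this
  dvd i hi := by
    have := h.dvd (n - 1 - i) (by omega)
    rwa [show n - 1 - i + 1 = n + 1 - (i + 1) by omega,
      show n - 1 - i + 2 = n + 1 - i by omega,
      show n - 1 - i = n + 1 - (i + 2) by omega,
      add_comm (a _)] at this

theorem reverseTuple_reverseTuple {n i : ℕ} (a : ℕ → ℕ) (hi : i ≤ n + 1) :
    reverseTuple n (reverseTuple n a) i = a i := by
  simp only [reverseTuple]
  congr 1
  omega

theorem DiamondRule.dvd_left {n : ℕ} {a b : ℕ → ℕ} (h : DiamondRule n a b)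
    (ha : a 0 = 1) (hb : b 0 = 1) {i : ℕ} (hi : i < n) : a (i + 1) ∣ a i + a (i + 2) := by
  cases i with
  | zero =>
    have := h 0 hi
    exact ⟨b 1, by simp_all⟩
  | succ j =>
    have h1 := h j (by omega)
    have h2 := h (j + 1) hi
    have hdvd : a (j + 2) ∣ b (j + 1) * (a (j + 1) + a (j + 3)) := by
      refine ⟨b j + b (j + 2), ?_⟩
      linarith
    refine Nat.Coprime.dvd_of_dvd_mul_left ?_ hdvd
    refine Nat.Coprime.symm (Nat.isCoprime_iff_coprime.mp ⟨a (j + 1), -b j, ?_⟩)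
    zify at h1
    linarith

theorem IsDivisibleTuple.exists_next {n : ℕ} {a : ℕ → ℕ} (h : IsDivisibleTuple n a) :
    ∃ b, IsDivisibleTuple n b ∧ DiamondRule n a b := by
  let b : ℕ → ℕ := fun i ↦ Nat.rec 1
    (fun j x ↦ if j < n then (1 + a (j + 2) * x) / a (j + 1) else 1) i
  have hb0 : b 0 = 1 := rfl
  have hbs (i : ℕ) : b (i + 1) = if i < n then (1 + a (i + 2) * b i) / a (i + 1) else 1 := rfl
  have hab : DiamondRule n a b := by
    intro i
    induction i with
    | zero =>
      intro hi
      have hd := h.dvd 0 hi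
      rw [hbs, if_pos hi, Nat.mul_div_cancel']
      simpa [h.zero, hb0] using hd
    | succ j ih =>
      intro hi
      have h1 := ih (by omega)
      have hd := h.dvd (j + 1) hi
      rw [hbs, if_pos hi, Nat.mul_div_cancel']
      refine (Nat.dvd_add_right (Dvd.intro (b j) rfl)).mp (?_ : a (j + 2) ∣ a (j + 2) * b j + _)
      have : a (j + 2) * b j + (1 + a (j + 3) * b (j + 1))
          = (a (j + 1) + a (j + 3)) * b (j + 1) := by linarith
      exact this ▸ hd.mul_right _
  have hlast : b (n + 1) = 1 := by simp [hbs]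
  refine ⟨b, ⟨hb0, hlast, fun i hi ↦ ?_, fun i hi ↦ ?_⟩, hab⟩
  · have := hab i hi
    exact Nat.pos_of_ne_zero fun h0 ↦ by rw [h0] at this; omega
  · have := hab.reverse.dvd_left hlast h.last (i := n - 1 - i) (by omega)
    simp only [reverseTuple] at this
    rwa [show n + 1 - (n - 1 - i + 1) = i + 1 by omega, show n + 1 - (n - 1 - i) = i + 2 by omega,
      show n + 1 - (n - 1 - i + 2) = i by omega, add_comm (b (i + 2))] at this

theorem IsDivisibleTuple.exists_prev {n : ℕ} {a : ℕ → ℕ} (h : IsDivisibleTuple n a) :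
    ∃ c, IsDivisibleTuple n c ∧ DiamondRule n c a := by
  obtain ⟨b, hb, hab⟩ := h.reverse.exists_next
  refine ⟨reverseTuple n b, hb.reverse, fun i hi ↦ ?_⟩
  have := hab.reverse i hi
  rwa [reverseTuple_reverseTuple a (by omega), reverseTuple_reverseTuple a (by omega)] at this

/-- A relation that is serial in both directions has a bi-infinite chain through any point. -/
theorem exists_int_chain {α : Type*} {r : α → α → Prop} (next : ∀ x, ∃ y, r x y)
    (prev : ∀ x, ∃ y, r y x) (x : α) : ∃ g : ℤ → α, g 0 = x ∧ ∀ m, r (g m) (g (m + 1)) := by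
  choose s hs using next
  choose p hp using prev
  let g : ℤ → α := fun m ↦ Int.rec (fun k ↦ s^[k] x) (fun k ↦ p^[k + 1] x) m
  refine ⟨g, rfl, fun m ↦ ?_⟩
  match m with
  | Int.ofNat k =>
    change r (s^[k] x) (s^[k + 1] x)
    rw [Function.iterate_succ_apply']
    exact hs _
  | Int.negSucc 0 => exact hp x
  | Int.negSucc (k + 1) =>
    change r (p^[k + 1 + 1] x) (p^[k + 1] x)
    rw [Function.iterate_succ_apply' p (k + 1)]
    exact hp _

/-- An `n`-tuple of positive integers (encoded as `a : ℕ → ℕ` with the conventions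
`a 0 = a (n+1) = 1` and `a i > 0` for `1 ≤ i ≤ n`) is a diagonal of a frieze
pattern of type `Aₙ` if and only if `a i` divides `a (i-1) + a (i+1)` for all
`1 ≤ i ≤ n`. -/
theorem diagonal_iff_divisibility (n : ℕ) (hn : 0 < n) (a : ℕ → ℕ)
    (h0 : a 0 = 1) (hlast : a (n + 1) = 1)
    (hpos : ∀ i : ℕ, 1 ≤ i → i ≤ n → 0 < a i) :
    (∃ f : ℕ × ℤ → ℕ, IsFriezeA n f ∧
        ∃ m : ℤ, ∀ i : ℕ, 1 ≤ i → i ≤ n → a i = f (i, m)) ↔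
      (∀ i : ℕ, 1 ≤ i → i ≤ n → a i ∣ a (i - 1) + a (i + 1)) := by
  constructor
  · rintro ⟨f, ⟨hf0, hf1, -, hf⟩, m, hm⟩
    have ha (i : ℕ) (hi : i ≤ n + 1) : a i = f (i, m) := by
      rcases Nat.eq_zero_or_pos i with rfl | hpos'
      · rw [h0, hf0]
      · rcases hi.eq_or_lt with rfl | hlt
        · rw [hlast, hf1]
        · exact hm i hpos' (by omega)
    have hrule : DiamondRule n (fun i ↦ f (i, m)) (fun i ↦ f (i, m + 1)) :=
      fun i hi ↦ hf (i + 1) (by omega) (by omega) m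
    intro i hi hin
    obtain ⟨j, rfl⟩ := Nat.exists_eq_add_of_le' hi
    rw [ha _ (by omega), ha _ (by omega), ha _ (by omega)]
    exact hrule.dvd_left (hf0 _) (hf0 _) hin
  · intro hdvd
    have ha : IsDivisibleTuple n a :=
      ⟨h0, hlast, fun i hi ↦ hpos _ (by omega) hi, fun i hi ↦ hdvd (i + 1) (by omega) hi⟩
    obtain ⟨g, hg0, hg⟩ := exists_int_chain
      (r := fun x y : {a : ℕ → ℕ // IsDivisibleTuple n a} ↦ DiamondRule n x y)
      (fun x ↦ let ⟨b, hb, hxb⟩ := x.2.exists_next; ⟨⟨b, hb⟩, hxb⟩)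
      (fun x ↦ let ⟨b, hb, hbx⟩ := x.2.exists_prev; ⟨⟨b, hb⟩, hbx⟩) ⟨a, ha⟩
    refine ⟨fun p ↦ (g p.2).1 p.1, ⟨fun m ↦ (g m).2.zero, fun m ↦ (g m).2.last, ?_, ?_⟩,
      0, fun i _ _ ↦ by simp [hg0]⟩
    · intro i hi hin m
      obtain ⟨j, rfl⟩ := Nat.exists_eq_add_of_le' hi
      exact (g m).2.pos j hin
    · intro i hi hin m
      obtain ⟨j, rfl⟩ := Nat.exists_eq_add_of_le' hi
      exact hg m j hin
end

section
/- Let n be a positive integer. If an n-tuple (a_1,…,a_n) of positive integers satisfies condition (*), then a_i ≤ F_{n+2} for all i ∈ {1,…,n}, where F denotes the Fibonacci sequence. -/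
theorem eq_one_or_exists_eq_add_of_star (n : ℕ) (a : ℕ → ℕ)
    (h0 : a 0 = 1) (hlast : a (n + 1) = 1) (hpos : ∀ i ≤ n + 1, 0 < a i)
    (hstar : ∀ i < n, a (i + 1) ∣ a i + a (i + 2)) :
    (∀ i ≤ n + 1, a i = 1) ∨ ∃ k < n, a (k + 1) = a k + a (k + 2) := by
  have hmax : ∃ k, k ≤ n + 1 ∧ ∀ i ≤ n + 1, a i ≤ a k := by
    obtain ⟨k, hk, h⟩ := Finset.exists_max_image (Finset.range (n + 2)) a ⟨0, by simp⟩
    simp only [Finset.mem_range] at hk h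
    exact ⟨k, by omega, fun i hi => h i (by omega)⟩
  classical
  obtain ⟨hk, hle⟩ := Nat.find_spec hmax
  have hmin : ∀ j < Nat.find hmax, ¬ (j ≤ n + 1 ∧ ∀ i ≤ n + 1, a i ≤ a j) :=
    fun j hj => Nat.find_min hmax hj
  generalize Nat.find hmax = k at hk hle hmin
  have hlt : ∀ j < k, a j < a k := by
    intro j hj
    by_contra! h
    exact hmin j hj ⟨by omega, fun i hi => (hle i hi).trans h⟩
  rcases k with _ | k
  · left
    intro i hi
    have := hle i hi
    have := hpos i hi
    omega
  · right
    have hne : k ≠ n := by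
      rintro rfl
      have := hlt 0 (by omega)
      omega
    refine ⟨k, by omega, ?_⟩
    obtain ⟨c, hc⟩ := hstar k (by omega)
    have h1 := hlt k (by omega)
    have h2 := hle (k + 2) (by omega)
    have h3 := hpos k (by omega)
    have hc2 : c < 2 := by
      by_contra! h
      nlinarith
    interval_cases c <;> omega

theorem star_remove (n k : ℕ) (a : ℕ → ℕ) (hk : k < n + 1)
    (hstar : ∀ i < n + 1, a (i + 1) ∣ a i + a (i + 2)) (hsum : a (k + 1) = a k + a (k + 2)) :
    ∀ i < n, (fun j => if j ≤ k then a j else a (j + 1)) (i + 1) ∣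
      (fun j => if j ≤ k then a j else a (j + 1)) i +
        (fun j => if j ≤ k then a j else a (j + 1)) (i + 2) := by
  intro i hi
  dsimp only
  rcases lt_trichotomy (i + 1) k with h | rfl | h
  · rw [if_pos (by omega), if_pos (by omega), if_pos (by omega)]
    exact hstar i (by omega)
  · rw [if_pos (by omega), if_pos (by omega), if_neg (by omega)]
    have := hstar i (by omega)
    rw [hsum, add_left_comm] at this
    exact (Nat.dvd_add_right dvd_rfl).1 this
  · rw [if_neg (by omega : ¬ i + 1 ≤ k), if_neg (by omega : ¬ i + 2 ≤ k)]
    have := hstar (i + 1) (by omega)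
    split_ifs with h'
    · obtain rfl : i = k := by omega
      rw [hsum, add_right_comm (a i)] at this
      exact (Nat.dvd_add_left dvd_rfl).1 this
    · exact this

theorem le_fib_and_add_le_fib_of_star (n : ℕ) : ∀ a : ℕ → ℕ, a 0 = 1 → a (n + 1) = 1 →
    (∀ i ≤ n + 1, 0 < a i) → (∀ i < n, a (i + 1) ∣ a i + a (i + 2)) →
    (∀ i ≤ n + 1, a i ≤ Nat.fib (n + 2)) ∧ ∀ i ≤ n, a i + a (i + 1) ≤ Nat.fib (n + 3) := by
  induction n with
  | zero =>
    intro a h0 h1 _ _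
    refine ⟨fun i hi => ?_, fun i hi => ?_⟩
    · interval_cases i <;> simp_all
    · interval_cases i
      simp_all [Nat.fib_add_two]
  | succ n ih =>
    intro a h0 hlast hpos hstar
    have hfib : Nat.fib (n + 1 + 3) = Nat.fib (n + 2) + Nat.fib (n + 3) := Nat.fib_add_two
    have hfib' : Nat.fib (n + 3) = Nat.fib (n + 1) + Nat.fib (n + 2) := Nat.fib_add_two
    have hfib_pos : 0 < Nat.fib (n + 1) := Nat.fib_pos.2 (by omega)
    have hfib_pos' : 0 < Nat.fib (n + 2) := Nat.fib_pos.2 (by omega)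
    rw [show n + 1 + 2 = n + 3 from rfl, hfib]
    rcases eq_one_or_exists_eq_add_of_star (n + 1) a h0 hlast hpos hstar with h | ⟨k, hk, hsum⟩
    · refine ⟨fun i hi => ?_, fun i hi => ?_⟩
      · rw [h i hi]
        omega
      · rw [h i (by omega), h (i + 1) (by omega)]
        omega
    · obtain ⟨hb, hbs⟩ := ih (fun j => if j ≤ k then a j else a (j + 1)) (by simpa using h0)
        (by simpa [show ¬ n + 1 ≤ k by omega] using hlast)
        (fun i hi => by split_ifs <;> exact hpos _ (by omega))
        (star_remove n k a hk hstar hsum)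
      have hle : ∀ i ≤ n + 2, i ≠ k + 1 → a i ≤ Nat.fib (n + 2) := by
        intro i hi hne
        rcases Nat.lt_or_ge k i with h | h
        · have := hb (i - 1) (by omega)
          rwa [if_neg (by omega), Nat.sub_add_cancel (by omega)] at this
        · have := hb i (by omega)
          rwa [if_pos h] at this
      have hmid : a (k + 1) ≤ Nat.fib (n + 3) := by
        have := hbs k (by omega)
        rw [if_pos le_rfl, if_neg (by omega)] at this
        rwa [hsum]
      have hall : ∀ i ≤ n + 2, a i ≤ Nat.fib (n + 3) := by
        intro i hi
        by_cases h : i = k + 1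
        · rwa [h]
        · have := hle i hi h
          omega
      refine ⟨hall, fun i hi => ?_⟩
      by_cases h : i = k + 1
      · have := hall i (by omega)
        have := hle (i + 1) (by omega) (by omega)
        omega
      · have := hle i (by omega) h
        have := hall (i + 1) (by omega)
        omega

/-- If an `n`-tuple of positive integers (encoded as `a : ℕ → ℕ` with the conventions
`a 0 = a (n+1) = 1` and `a i > 0` for `1 ≤ i ≤ n`) satisfies the condition (*) that
`a i` divides `a (i-1) + a (i+1)` for all `1 ≤ i ≤ n`, then `a i ≤ F (n+2)` for all
`1 ≤ i ≤ n`, where `F` is the Fibonacci sequence. -/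
theorem tuple_le_fib_of_star (n : ℕ) (hn : 0 < n) (a : ℕ → ℕ)
    (h0 : a 0 = 1) (hlast : a (n + 1) = 1)
    (hpos : ∀ i : ℕ, 1 ≤ i → i ≤ n → 0 < a i)
    (hstar : ∀ i : ℕ, 1 ≤ i → i ≤ n → a i ∣ a (i - 1) + a (i + 1)) :
    ∀ i : ℕ, 1 ≤ i → i ≤ n → a i ≤ Nat.fib (n + 2) := by
  intro i _ hi
  refine (le_fib_and_add_le_fib_of_star n a h0 hlast (fun j hj => ?_) fun j hj => ?_).1 i (by omega)
  · rcases Nat.eq_zero_or_pos j with rfl | h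
    · omega
    · rcases hj.lt_or_eq with h' | rfl
      · exact hpos j h (by omega)
      · omega
  · exact hstar (j + 1) (by omega) (by omega)
end

section
/- Let n be an even positive integer. The n-tuple (F_4, F_6, …, F_n, F_{n+2}, F_{n+1}, F_{n-1}, …, F_5, F_3), whose first n/2 entries are the even-indexed Fibonacci numbers F_4, F_6, …, F_{n+2} in increasing order of index and whose last n/2 entries are the odd-indexed Fibonacci numbers F_{n+1}, F_{n-1}, …, F_3 in decreasing order of index, satisfies condition (*). -/
theorem fib_add_fib_add_four (k : ℕ) :
    Nat.fib k + Nat.fib (k + 4) = 3 * Nat.fib (k + 2) := by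
  have h2 : Nat.fib (k + 2) = Nat.fib k + Nat.fib (k + 1) := Nat.fib_add_two
  have h3 : Nat.fib (k + 3) = Nat.fib (k + 1) + Nat.fib (k + 2) := Nat.fib_add_two
  have h4 : Nat.fib (k + 4) = Nat.fib (k + 2) + Nat.fib (k + 3) := Nat.fib_add_two
  omega

theorem fib_add_fib_add_three (k : ℕ) :
    Nat.fib k + Nat.fib (k + 3) = 2 * Nat.fib (k + 2) := by
  have h2 : Nat.fib (k + 2) = Nat.fib k + Nat.fib (k + 1) := Nat.fib_add_two
  have h3 : Nat.fib (k + 3) = Nat.fib (k + 1) + Nat.fib (k + 2) := Nat.fib_add_two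
  omega

/-- For even positive `n`, the `n`-tuple
`(F 4, F 6, …, F n, F (n+2), F (n+1), F (n-1), …, F 5, F 3)` — whose `i`-th entry
is `F (2i+2)` for `1 ≤ i ≤ n/2` (the even-indexed Fibonacci numbers `F 4, …, F (n+2)`
in increasing order) and `F (2(n-i)+3)` for `n/2 < i ≤ n` (the odd-indexed Fibonacci
numbers `F (n+1), …, F 3` in decreasing order) — together with the conventions
`a 0 = a (n+1) = 1`, satisfies condition (*): `a i ∣ a (i-1) + a (i+1)` for
all `1 ≤ i ≤ n`. -/
theorem zigzag_even_satisfies_star (n : ℕ) (hn : 0 < n) (hev : Even n)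
    (a : ℕ → ℕ) (h0 : a 0 = 1) (hlast : a (n + 1) = 1)
    (hfirst : ∀ i : ℕ, 1 ≤ i → 2 * i ≤ n → a i = Nat.fib (2 * i + 2))
    (hsecond : ∀ i : ℕ, n < 2 * i → i ≤ n → a i = Nat.fib (2 * (n - i) + 3)) :
    ∀ i : ℕ, 1 ≤ i → i ≤ n → a i ∣ a (i - 1) + a (i + 1) := by
  obtain ⟨m, rfl⟩ := hev
  have left : ∀ i ≤ m, a i = Nat.fib (2 * i + 2) := by
    intro i hi
    rcases Nat.eq_zero_or_pos i with rfl | hpos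
    · simpa using h0
    · exact hfirst i hpos (by omega)
  have right : ∀ i j, i + j = m + m + 1 → j ≤ m → a i = Nat.fib (2 * j + 1) := by
    intro i j hij hj
    rcases Nat.eq_zero_or_pos j with rfl | hpos
    · obtain rfl : i = m + m + 1 := hij
      simpa using hlast
    · rw [hsecond i (by omega) (by omega)]
      congr 1
      omega
  intro i hi hin
  rcases lt_trichotomy i m with him | rfl | him
  · obtain ⟨k, rfl⟩ := Nat.exists_eq_add_of_le' hi
    rw [left (k + 1) (by omega), Nat.add_sub_cancel, left k (by omega), left (k + 1 + 1) him]
    exact Dvd.intro_left 3 (fib_add_fib_add_four (2 * k + 2)).symm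
  · obtain ⟨k, rfl⟩ := Nat.exists_eq_add_of_le' hi
    rw [left (k + 1) le_rfl, Nat.add_sub_cancel, left k (by omega),
      right (k + 1 + 1) (k + 1) (by omega) le_rfl]
    exact dvd_of_eq (Nat.fib_add_two (n := 2 * k + 2))
  · obtain ⟨j, hj⟩ : ∃ j, i + (j + 1) = m + m + 1 := ⟨m + m - i, by omega⟩
    rw [right i (j + 1) hj (by omega), right (i + 1) j (by omega) (by omega),
      add_comm (a (i - 1))]
    rcases Nat.eq_or_lt_of_le (show j + 1 ≤ m by omega) with rfl | hjm
    · rw [left (i - 1) (by omega), show 2 * (i - 1) + 2 = 2 * j + 1 + 3 by omega]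
      exact Dvd.intro_left 2 (fib_add_fib_add_three (2 * j + 1)).symm
    · rw [right (i - 1) (j + 2) (by omega) hjm]
      exact Dvd.intro_left 3 (fib_add_fib_add_four (2 * j + 1)).symm
end

section
/- Let n be an odd positive integer. The n-tuple (F_4, F_6, …, F_{n+1}, F_{n+2}, F_n, F_{n-2}, …, F_5, F_3), whose first (n-1)/2 entries are the even-indexed Fibonacci numbers F_4, F_6, …, F_{n+1} in increasing order of index, whose middle entry is F_{n+2}, and whose last (n-1)/2 entries are the odd-indexed Fibonacci numbers F_n, F_{n-2}, …, F_3 in decreasing order of index, satisfies condition (*). -/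
/-- For odd positive `n`, the `n`-tuple
`(F 4, F 6, …, F (n+1), F (n+2), F n, F (n-2), …, F 5, F 3)` — whose `i`-th entry
is `F (2i+2)` for `1 ≤ i ≤ (n-1)/2` (i.e. `2i ≤ n`; the even-indexed Fibonacci
numbers `F 4, …, F (n+1)` in increasing order), whose middle entry at `i = (n+1)/2`
is `F (2(n-i)+3) = F (n+2)`, and whose entry is `F (2(n-i)+3)` for `(n+1)/2 < i ≤ n`
(the odd-indexed Fibonacci numbers `F n, …, F 3` in decreasing order) — together
with the conventions `a 0 = a (n+1) = 1`, satisfies condition (*):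
`a i ∣ a (i-1) + a (i+1)` for all `1 ≤ i ≤ n`. -/
theorem zigzag_odd_satisfies_star (n : ℕ) (hn : 0 < n) (hodd : Odd n)
    (a : ℕ → ℕ) (h0 : a 0 = 1) (hlast : a (n + 1) = 1)
    (hfirst : ∀ i : ℕ, 1 ≤ i → 2 * i ≤ n → a i = Nat.fib (2 * i + 2))
    (hsecond : ∀ i : ℕ, n < 2 * i → i ≤ n → a i = Nat.fib (2 * (n - i) + 3)) :
    ∀ i : ℕ, 1 ≤ i → i ≤ n → a i ∣ a (i - 1) + a (i + 1) := by
  obtain ⟨m, rfl⟩ := hodd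
  have left_eq : ∀ i ≤ m, a i = Nat.fib (2 * i + 2) := by
    intro i hi
    rcases Nat.eq_zero_or_pos i with rfl | hpos
    · simpa using h0
    · exact hfirst i hpos (by omega)
  have right_eq : ∀ i j, i + j = 2 * m + 2 → j ≤ m + 1 → a i = Nat.fib (2 * j + 1) := by
    intro i j hij hj
    rcases Nat.eq_zero_or_pos j with rfl | hpos
    · obtain rfl : i = 2 * m + 1 + 1 := by omega
      simpa using hlast
    · rw [hsecond i (by omega) (by omega)]
      congr 1
      omega
  intro i hi hin
  obtain ⟨k, rfl⟩ : ∃ k, i = k + 1 := ⟨i - 1, by omega⟩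
  rw [Nat.add_sub_cancel]
  rcases lt_trichotomy k m with hk | rfl | hk
  · rw [left_eq k hk.le, left_eq (k + 1) hk]
    rcases (Nat.succ_le_of_lt hk).lt_or_eq with hlt | rfl
    · rw [left_eq (k + 1 + 1) hlt]
      exact Dvd.intro_left 3 (fib_add_fib_add_four (2 * k + 2)).symm
    · rw [right_eq (k + 1 + 1) (k + 2) (by omega) (by omega)]
      refine ⟨2, ?_⟩
      have h4 : Nat.fib (2 * k + 4) = _ := Nat.fib_add_two (n := 2 * k + 2)
      have h5 : Nat.fib (2 * k + 5) = _ := Nat.fib_add_two (n := 2 * k + 3)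
      change Nat.fib (2 * k + 2) + Nat.fib (2 * k + 5) = Nat.fib (2 * k + 4) * 2
      simp only [Nat.add_assoc, Nat.reduceAdd] at h4 h5
      omega
  · rw [left_eq k le_rfl, right_eq (k + 1) (k + 1) (by omega) le_rfl,
      right_eq (k + 1 + 1) k (by omega) (by omega),
      add_comm (Nat.fib (2 * k + 2))]
    exact dvd_of_eq (Nat.fib_add_two (n := 2 * k + 1))
  · obtain ⟨j, hj⟩ : ∃ j, k + 1 + 1 + j = 2 * m + 2 := ⟨2 * m - k, by omega⟩
    rw [right_eq k (j + 2) (by omega) (by omega), right_eq (k + 1) (j + 1) (by omega) (by omega),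
      right_eq (k + 1 + 1) j hj (by omega), add_comm (Nat.fib (2 * (j + 2) + 1))]
    exact Dvd.intro_left 3 (fib_add_fib_add_four (2 * j + 1)).symm
end

section
/- Let n be a positive integer. If an n-tuple (a_1,…,a_n) of positive integers satisfies condition (*) and a_n ≠ 1, then there exists an index i ∈ {1,…,n} such that a_i = a_{i-1} + a_{i+1} (with the conventions a_0 = a_{n+1} = 1). -/
/-- If an `n`-tuple of positive integers (encoded as `a : ℕ → ℕ` with the conventions
`a 0 = a (n+1) = 1` and `a i > 0` for `1 ≤ i ≤ n`) satisfies condition (*) and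
`a n ≠ 1`, then there is an index `1 ≤ i ≤ n` with `a i = a (i-1) + a (i+1)`. -/
theorem exists_sum_of_star (n : ℕ) (hn : 0 < n) (a : ℕ → ℕ)
    (h0 : a 0 = 1) (hlast : a (n + 1) = 1)
    (hpos : ∀ i : ℕ, 1 ≤ i → i ≤ n → 0 < a i)
    (hstar : ∀ i : ℕ, 1 ≤ i → i ≤ n → a i ∣ a (i - 1) + a (i + 1))
    (hne : a n ≠ 1) :
    ∃ i : ℕ, 1 ≤ i ∧ i ≤ n ∧ a i = a (i - 1) + a (i + 1) := by
  by_contra! h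
  have mono : ∀ i ≤ n, a i ≤ a (i + 1) := by
    intro i
    induction i with
    | zero => intro _; have := hpos 1 le_rfl hn; simp only [zero_add]; omega
    | succ k ih =>
      intro hk
      have hle := ih (by omega)
      have hp := hpos (k + 1) (by omega) hk
      have hk_ne := h (k + 1) (by omega) hk
      obtain ⟨c, hc⟩ := hstar (k + 1) (by omega) hk
      rw [Nat.add_sub_cancel] at hk_ne hc
      have hc2 : 2 ≤ c := by
        rcases c with _ | _ | c
        · rw [Nat.mul_zero] at hc
          have hk0 : a k = 0 := by omega
          rcases Nat.eq_zero_or_pos k with rfl | hkpos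
          · omega
          · exact absurd hk0 (hpos k hkpos (by omega)).ne'
        · rw [zero_add, Nat.mul_one] at hc
          exact absurd hc.symm hk_ne
        · omega
      have := Nat.mul_le_mul_left (a (k + 1)) hc2
      omega
  have hlow := mono n le_rfl
  have hp := hpos n hn le_rfl
  omega
end

section
/- Every value of every frieze pattern of type A_2 is at most 3, and there exist a frieze pattern f of type A_2, an index i and an integer m with f(i,m) = 3; that is, the maximum value occurring in frieze patterns of type A_2 equals 3. -/
/-- Positive integers `x`, `y` with `x ∣ y + 1` and `y ∣ x + 1` are at most `3`. -/
theorem le_three_of_dvd_add_one {x y : ℕ} (hx : 0 < x) (hy : 0 < y)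
    (hxy : x ∣ y + 1) (hyx : y ∣ x + 1) : x ≤ 3 ∧ y ≤ 3 := by
  have h₁ : x ≤ y + 1 := Nat.le_of_dvd (by omega) hxy
  have h₂ : y ≤ x + 1 := Nat.le_of_dvd (by omega) hyx
  obtain rfl | rfl | rfl : x = y ∨ y = x + 1 ∨ x = y + 1 := by omega
  · have := Nat.le_of_dvd one_pos ((Nat.dvd_add_right dvd_rfl).1 hxy)
    omega
  · have := Nat.le_of_dvd two_pos ((Nat.dvd_add_right (dvd_refl x)).1 hxy)
    omega
  · have := Nat.le_of_dvd two_pos ((Nat.dvd_add_right (dvd_refl y)).1 hyx)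
    omega

/-- The `5`-periodic sequence `1, 1, 2, 3, 2, …`, which satisfies
`x (k - 1) * x (k + 1) = 1 + x k`. -/
def pentagonSeq (k : ℤ) : ℕ :=
  if k % 5 = 3 then 3 else if k % 5 = 2 ∨ k % 5 = 4 then 2 else 1

theorem pentagonSeq_pos (k : ℤ) : 0 < pentagonSeq k := by
  unfold pentagonSeq
  split_ifs <;> norm_num

theorem pentagonSeq_mul (k : ℤ) :
    pentagonSeq k * pentagonSeq (k + 2) = 1 + pentagonSeq (k + 1) := by
  unfold pentagonSeq
  split_ifs <;> omega

/-- The frieze pattern of type `A₂` whose rows interleave to `pentagonSeq`. -/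
def pentagonFrieze (p : ℕ × ℤ) : ℕ :=
  if p.1 = 1 then pentagonSeq (2 * p.2)
  else if p.1 = 2 then pentagonSeq (2 * p.2 + 1)
  else 1

theorem isFriezeA_pentagonFrieze : IsFriezeA 2 pentagonFrieze := by
  refine ⟨fun m => by simp [pentagonFrieze], fun m => by simp [pentagonFrieze],
    fun i _ _ m => ?_, fun i hi₁ hi₂ m => ?_⟩
  · unfold pentagonFrieze
    split_ifs
    exacts [pentagonSeq_pos _, pentagonSeq_pos _, one_pos]
  · obtain rfl | rfl : i = 1 ∨ i = 2 := by omega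
    · simpa [pentagonFrieze, mul_add] using pentagonSeq_mul (2 * m)
    · have h := pentagonSeq_mul (2 * m + 1)
      rw [show 2 * m + 1 + 2 = 2 * (m + 1) + 1 by ring,
        show 2 * m + 1 + 1 = 2 * (m + 1) by ring] at h
      simpa [pentagonFrieze] using h

/-- The maximum value occurring in frieze patterns of type `A₂` is exactly `3`:
every value of every frieze pattern of type `A₂` is at most `3`, and some frieze
pattern of type `A₂` attains the value `3`. -/
theorem frieze_A2_max_eq_three :
    (∀ f : ℕ × ℤ → ℕ, IsFriezeA 2 f →
      ∀ i : ℕ, 1 ≤ i → i ≤ 2 → ∀ m : ℤ, f (i, m) ≤ 3) ∧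
    (∃ f : ℕ × ℤ → ℕ, IsFriezeA 2 f ∧
      ∃ i : ℕ, 1 ≤ i ∧ i ≤ 2 ∧ ∃ m : ℤ, f (i, m) = 3) := by
  refine ⟨fun f ⟨h₀, h₃, hpos, hmul⟩ i hi₁ hi₂ m => ?_,
    pentagonFrieze, isFriezeA_pentagonFrieze, 2, by norm_num, le_rfl, 1, rfl⟩
  have row₁ := hmul 1 le_rfl one_le_two m
  have row₂ := hmul 2 one_le_two le_rfl (m - 1)
  norm_num at h₃ row₁ row₂
  rw [h₀, mul_one] at row₁
  rw [h₃, one_mul] at row₂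
  obtain ⟨ha, hb⟩ := le_three_of_dvd_add_one (hpos 1 le_rfl one_le_two m)
    (hpos 2 one_le_two le_rfl m) ⟨_, by rw [row₁, add_comm]⟩
    ⟨_, by rw [mul_comm, row₂, add_comm]⟩
  obtain rfl | rfl : i = 1 ∨ i = 2 := by omega
  exacts [ha, hb]
end

section
/- Let n be a positive integer and let a be a frieze pattern of type A_{2n-1} such that a(n+j, m) = a(n-j, m+j) for all j ∈ {1,…,n-1} and all m ∈ ℤ. Then the function c : {1,…,n} × ℤ → ℤ_{>0} defined by c(n-i, m) = a(n-i, -m+i) for i ∈ {0,…,n-1} and m ∈ ℤ is a frieze pattern of type C_n. -/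
/-- Folding: if `a` is a frieze pattern of type `A_(2n-1)` satisfying
`a (n+j, m) = a (n-j, m+j)` for `1 ≤ j ≤ n-1` and all `m`, then the map `c`
defined by `c (n-i, m) = a (n-i, -m+i)` for `0 ≤ i ≤ n-1` (with the convention
`c (0, m) = 1`) is a frieze pattern of type `Cₙ`. -/
theorem folding_A_to_C (n : ℕ) (hn : 0 < n) (a : ℕ × ℤ → ℕ)
    (ha : IsFriezeA (2 * n - 1) a)
    (hsymm : ∀ j : ℕ, 1 ≤ j → j ≤ n - 1 → ∀ m : ℤ, a (n + j, m) = a (n - j, m + j))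
    (c : ℕ × ℤ → ℕ)
    (hc0 : ∀ m : ℤ, c (0, m) = 1)
    (hc : ∀ i : ℕ, i ≤ n - 1 → ∀ m : ℤ, c (n - i, m) = a (n - i, -m + i)) :
    IsFriezeC n c := by
  obtain ⟨ha0, ha1, hpos, hrule⟩ := ha
  have key : ∀ k ≤ n, ∀ m : ℤ, c (k, m) = a (k, -m + n - k) := by
    intro k hk m
    rcases Nat.eq_zero_or_pos k with rfl | hk0
    · rw [hc0, ha0]
    · have h := hc (n - k) (by omega) m
      rw [Nat.sub_sub_self hk, Nat.cast_sub hk] at h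
      rw [h, add_sub_assoc]
  have hmid : ∀ m : ℤ, a (n + 1, m) = a (n - 1, m + 1) := by
    intro m
    rcases Nat.lt_or_ge 1 n with h | h
    · exact_mod_cast hsymm 1 le_rfl (by omega) m
    · obtain rfl : n = 1 := by omega
      exact (ha1 m).trans (ha0 _).symm
  refine ⟨hc0, fun i hi hin m => ?_, fun i hi hin m => ?_, fun m => ?_⟩
  · rw [key i hin]
    exact hpos i hi (by omega) _
  · have h := hrule i hi (by omega) (-(m + 1) + n - i)
    rw [key i (by omega), key i (by omega), key (i + 1) (by omega), key (i - 1) (by omega),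
      mul_comm, Nat.cast_sub hi]
    convert h using 4 <;> push_cast <;> ring_nf
  · have h := hrule n hn (by omega) (-(m + 1))
    rw [hmid] at h
    rw [key n le_rfl, key n le_rfl, key (n - 1) (by omega), mul_comm, Nat.cast_sub hn, sq]
    convert h using 4 <;> push_cast <;> ring_nf
end

section
/- Let n be a positive integer. For every frieze pattern c of type C_n there exists a frieze pattern a of type A_{2n-1} satisfying a(n+j, m) = a(n-j, m+j) for all j ∈ {1,…,n-1} and all m ∈ ℤ, such that c(n-i, m) = a(n-i, -m+i) for all i ∈ {0,…,n-1} and all m ∈ ℤ. -/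
/-- A function whose lower half is `c`, with the second coordinate reversed and sheared,
and whose upper half is the reflection of the lower half in the row `n`. -/
lemma exists_unfolding {α : Type*} (n : ℕ) (c : ℕ × ℤ → α) :
    ∃ a : ℕ × ℤ → α, (∀ i : ℕ, i ≤ n → ∀ m : ℤ, a (i, m) = c (i, n - i - m)) ∧
      (∀ j : ℕ, j ≤ n → ∀ m : ℤ, a (n + j, m) = c (n - j, -m)) := by
  refine ⟨fun p => if p.1 ≤ n then c (p.1, n - p.1 - p.2) else c (2 * n - p.1, -p.2),
    fun i hi m => if_pos hi, fun j _ m => ?_⟩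
  rcases Nat.eq_zero_or_pos j with rfl | hj
  · simp
  · simp [hj.ne', show 2 * n - (n + j) = n - j by lia]


/-- Unfolding: every frieze pattern `c` of type `Cₙ` arises from a frieze pattern
`a` of type `A_(2n-1)` satisfying `a (n+j, m) = a (n-j, m+j)` for `1 ≤ j ≤ n-1`,
via `c (n-i, m) = a (n-i, -m+i)` for `0 ≤ i ≤ n-1`. -/
theorem unfolding_C_to_A (n : ℕ) (hn : 0 < n) (c : ℕ × ℤ → ℕ)
    (hc : IsFriezeC n c) :
    ∃ a : ℕ × ℤ → ℕ, IsFriezeA (2 * n - 1) a ∧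
      (∀ j : ℕ, 1 ≤ j → j ≤ n - 1 → ∀ m : ℤ, a (n + j, m) = a (n - j, m + j)) ∧
      (∀ i : ℕ, i ≤ n - 1 → ∀ m : ℤ, c (n - i, m) = a (n - i, -m + i)) := by
  obtain ⟨a, lower, upper⟩ := exists_unfolding n c
  obtain ⟨h0, hpos, hdiamond, hmid⟩ := hc
  refine ⟨a, ⟨fun m => ?_, fun m => ?_, fun i hi hi' m => ?_, fun i hi hi' m => ?_⟩,
    fun j hj hj' m => ?_, fun i hi m => ?_⟩
  · rw [lower 0 (by lia), h0]
  · rw [show 2 * n - 1 + 1 = n + n by lia, upper n le_rfl, Nat.sub_self, h0]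
  · rcases le_total i n with h | h
    · rw [lower i h]
      exact hpos _ hi h _
    · obtain ⟨j, rfl⟩ := Nat.exists_eq_add_of_le h
      rw [upper j (by lia)]
      exact hpos _ (by lia) (by lia) _
  · rcases lt_trichotomy i n with h | rfl | h
    · have key := hdiamond i hi (by lia) (n - i - m - 1)
      rw [lower i h.le, lower i h.le, lower (i + 1) h, lower (i - 1) (by lia), mul_comm]
      push_cast [Nat.cast_sub hi]
      ring_nf at key ⊢
      exact key
    · have key := hmid (-m - 1)
      rw [lower i le_rfl, lower i le_rfl, upper 1 hi, lower (i - 1) (by lia), mul_comm]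
      push_cast [Nat.cast_sub hi]
      ring_nf at key ⊢
      exact key
    · obtain ⟨j, rfl⟩ := Nat.exists_eq_add_of_le h.le
      have key := hdiamond (n - j) (by lia) (by lia) (-m - 1)
      rw [upper j (by lia), upper j (by lia), add_assoc, upper (j + 1) (by lia),
        show n + j - 1 = n + (j - 1) by lia, upper (j - 1) (by lia),
        show n - (j + 1) = n - j - 1 by lia, show n - (j - 1) = n - j + 1 by lia,
        show -(m + 1) = -m - 1 by ring, mul_comm, mul_comm (c (n - j - 1, -m))]
      rwa [show -m - 1 + 1 = -m by ring] at key
  · rw [upper j (by lia), lower (n - j) (by lia), Nat.cast_sub (by lia)]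
    ring_nf
  · rw [lower (n - i) (by lia), Nat.cast_sub (by lia)]
    ring_nf
end

section
/- For every positive integer n, there exists a frieze pattern c of type C_n such that c(i, 0) = F_{2i+1} for all i ∈ {1,…,n}, where F denotes the Fibonacci sequence; in particular c(n,0) = F_{2n+1}. -/
namespace Int

theorem fib_odd_mul_fib_odd (k : ℤ) :
    fib (2 * k + 3) * fib (2 * k - 1) = 1 + fib (2 * k + 1) ^ 2 := by
  have h := fib_add_sq_sub_fib_mul_fib_add_two_mul (2 * k - 1) 2
  have e : Odd (2 * k - 1).natAbs := by
    rw [natAbs_odd]; exact ⟨k - 1, by ring⟩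
  rw [e.neg_one_pow, fib_two, show 2 * k - 1 + 2 = 2 * k + 1 by ring,
    show 2 * k - 1 + 2 * 2 = 2 * k + 3 by ring] at h
  linear_combination -h

theorem fib_even_sq (k : ℤ) :
    fib (2 * k + 2) ^ 2 = 1 + fib (2 * k + 4) * fib (2 * k) := by
  have h := fib_add_sq_sub_fib_mul_fib_add_two_mul (2 * k) 2
  have e : Even (2 * k).natAbs := by
    rw [natAbs_even]; exact even_two_mul k
  rw [e.neg_one_pow, fib_two, show 2 * k + 2 * 2 = 2 * k + 4 by ring] at h
  linear_combination h

theorem fib_odd_mul_fib_even (k : ℤ) :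
    fib (2 * k + 1) * fib (2 * k + 2) = 1 + fib (2 * k + 3) * fib (2 * k) := by
  have h := fib_even_sq k
  have h2 := fib_add_two (2 * k)
  have h3 := fib_add_two (2 * k + 1)
  have h4 := fib_add_two (2 * k + 2)
  ring_nf at h h2 h3 h4 ⊢
  rw [h4] at h
  linear_combination h - fib (2 + k * 2) * h2

theorem fib_even_mul_fib_odd (k : ℤ) :
    fib (2 * k + 2) * fib (2 * k - 1) = 1 + fib (2 * k + 1) * fib (2 * k) := by
  have h := fib_odd_mul_fib_even k
  have h1 := fib_add_two (2 * k - 1)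
  have h3 := fib_add_two (2 * k + 1)
  ring_nf at h h1 h3 ⊢
  rw [h3] at h
  linear_combination h - fib (2 + k * 2) * h1

theorem fib_even_pos {k : ℤ} (hk : 0 ≤ k) : 0 < fib (2 * k + 2) := by
  rw [fib_of_nonneg (by lia)]
  exact_mod_cast Nat.fib_pos.2 (by lia)

end Int

/-- The entries of the frieze of type `Cₙ` with quiddity cycle `2, 3, …, 3, 1` of length `n + 1`:
`fibFrieze n i r` is the entry in row `i` and column `r`, for `0 ≤ i ≤ n` and `0 ≤ r ≤ n`. -/
def fibFrieze (n i r : ℤ) : ℤ :=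
  if r = 0 then Int.fib (2 * i + 1)
  else if r + i ≤ n then Int.fib (2 * i + 2)
  else Int.fib (2 * (2 * n - 2 * r - i + 1) + 1)

namespace fibFrieze

theorem col_zero (n i : ℤ) : fibFrieze n i 0 = Int.fib (2 * i + 1) := if_pos rfl

theorem of_add_le {n i r : ℤ} (hr : 0 < r) (h : r + i ≤ n) :
    fibFrieze n i r = Int.fib (2 * i + 2) := by
  rw [fibFrieze, if_neg hr.ne', if_pos h]

theorem of_lt_add {n i r : ℤ} (hr : 0 < r) (h : n < r + i) :
    fibFrieze n i r = Int.fib (2 * (2 * n - 2 * r - i + 1) + 1) := by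
  rw [fibFrieze, if_neg hr.ne', if_neg h.not_ge]

theorem pos {n i r : ℤ} (hi : 0 ≤ i) : 0 < fibFrieze n i r := by
  unfold fibFrieze
  split_ifs
  exacts [Int.fib_two_mul_add_one_pos, Int.fib_even_pos hi, Int.fib_two_mul_add_one_pos]

theorem row_zero {n r : ℤ} (hr : r ≤ n) : fibFrieze n 0 r = 1 := by
  unfold fibFrieze
  split_ifs
  · simp
  · simp
  · lia

theorem mul_succ {n i r : ℤ} (hin : i < n) (hr : 0 ≤ r) (hrn : r < n) :
    fibFrieze n i r * fibFrieze n i (r + 1) =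
      1 + fibFrieze n (i + 1) r * fibFrieze n (i - 1) (r + 1) := by
  rcases hr.eq_or_lt with rfl | hr
  · rw [col_zero, col_zero, of_add_le (by lia) (by lia), of_add_le (by lia) (by lia)]
    convert Int.fib_odd_mul_fib_even i using 4 <;> ring
  rcases lt_trichotomy (r + i) n with h | h | h
  · rw [of_add_le hr (by lia), of_add_le (by lia) (by lia), of_add_le hr (by lia),
      of_add_le (by lia) (by lia), ← sq]
    convert Int.fib_even_sq i using 4 <;> ring
  · rw [of_add_le hr (by lia), of_lt_add (by lia) (by lia), of_lt_add hr (by lia),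
      of_add_le (by lia) (by lia)]
    subst h
    convert Int.fib_even_mul_fib_odd i using 3 <;> ring_nf
  · rw [of_lt_add hr (by lia), of_lt_add (by lia) (by lia), of_lt_add hr (by lia),
      of_lt_add (by lia) (by lia)]
    have h := Int.fib_odd_mul_fib_odd (2 * n - 2 * r - i)
    rw [sq] at h
    convert h using 3 <;> ring_nf

theorem mul_wrap {n i : ℤ} (hi : 1 ≤ i) (hin : i ≤ n) :
    fibFrieze n i n * fibFrieze n i 0 =
      1 + fibFrieze n (i + 1) n * fibFrieze n (i - 1) 0 := by
  rw [col_zero, col_zero, of_lt_add (by lia) (by lia), of_lt_add (by lia) (by lia)]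
  have h := Int.fib_odd_mul_fib_odd (i - 1)
  have a : Int.fib (2 * (2 * n - 2 * n - i + 1) + 1) = Int.fib (2 * (i - 1) - 1) := by
    rw [Int.fib_of_odd ⟨_, rfl⟩, Int.fib_of_odd ⟨i - 2, by ring⟩]
    congr 2
    lia
  have b : Int.fib (2 * (2 * n - 2 * n - (i + 1) + 1) + 1) = Int.fib (2 * (i - 1) + 1) := by
    rw [Int.fib_of_odd ⟨_, rfl⟩, Int.fib_of_odd ⟨_, rfl⟩]
    congr 2
    lia
  rw [a, b, ← sq, ← h, mul_comm]
  ring_nf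

theorem last_mul_succ {n r : ℤ} (hr : 0 ≤ r) (hrn : r < n) :
    fibFrieze n n r * fibFrieze n n (r + 1) = 1 + fibFrieze n (n - 1) (r + 1) ^ 2 := by
  rcases hr.eq_or_lt with rfl | hr
  · rw [col_zero, of_lt_add (by lia) (by lia), of_add_le (by lia) (by lia)]
    have h1 := Int.fib_odd_mul_fib_even (n - 1)
    have h2 := Int.fib_add_two (2 * n - 1)
    have h4 := Int.fib_add_two (2 * n - 2)
    ring_nf at h1 h2 h4 ⊢
    rw [h2, h4] at h1 ⊢
    linear_combination h1
  · rw [of_lt_add hr (by lia), of_lt_add (by lia) (by lia), of_lt_add (by lia) (by lia)]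
    convert Int.fib_odd_mul_fib_odd (n - 2 * r) using 3 <;> ring_nf

theorem last_mul_wrap {n : ℤ} (hn : 1 ≤ n) :
    fibFrieze n n n * fibFrieze n n 0 = 1 + fibFrieze n (n - 1) 0 ^ 2 := by
  rw [mul_wrap hn le_rfl, sq]
  congr 2
  rw [col_zero, of_lt_add (by lia) (by lia), Int.fib_of_odd ⟨_, rfl⟩, Int.fib_of_odd ⟨_, rfl⟩]
  congr 2
  lia

end fibFrieze

theorem Int.add_one_emod_cases (m : ℤ) {n : ℤ} (hn : 0 ≤ n) :
    (m % (n + 1) < n ∧ (m + 1) % (n + 1) = m % (n + 1) + 1) ∨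
      (m % (n + 1) = n ∧ (m + 1) % (n + 1) = 0) := by
  have h1 := Int.emod_lt_of_pos m (show 0 < n + 1 by lia)
  have h0 := Int.emod_nonneg m (show n + 1 ≠ 0 by lia)
  rw [← Int.emod_add_emod]
  rcases (show m % (n + 1) ≤ n by lia).lt_or_eq with h | h
  · exact .inl ⟨h, Int.emod_eq_of_lt (by lia) (by lia)⟩
  · exact .inr ⟨h, by rw [h, Int.emod_self]⟩

/-- For every positive integer `n` there is a frieze pattern `c` of type `Cₙ` with
`c (i, 0) = F (2i+1)` for all `1 ≤ i ≤ n`; in particular `c (n, 0) = F (2n+1)`. -/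
theorem exists_frieze_C_with_fib_diagonal (n : ℕ) (hn : 0 < n) :
    ∃ c : ℕ × ℤ → ℕ, IsFriezeC n c ∧
      ∀ i : ℕ, 1 ≤ i → i ≤ n → c (i, 0) = Nat.fib (2 * i + 1) := by
  have hn' : (1 : ℤ) ≤ n := by exact_mod_cast hn
  have cast_toNat {i : ℤ} (r : ℤ) (hi : 0 ≤ i) :
      ((fibFrieze n i r).toNat : ℤ) = fibFrieze n i r :=
    Int.toNat_of_nonneg (fibFrieze.pos hi).le
  have emod_nonneg (m : ℤ) : 0 ≤ m % ((n : ℤ) + 1) := Int.emod_nonneg m (by lia)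
  have emod_lt (m : ℤ) : m % ((n : ℤ) + 1) < n + 1 := Int.emod_lt_of_pos m (by lia)
  refine ⟨fun p : ℕ × ℤ => (fibFrieze n p.1 (p.2 % (n + 1))).toNat, ⟨fun m => ?_, fun i _ _ m => ?_,
    fun i hi hin m => ?_, fun m => ?_⟩, fun i _ _ => ?_⟩
  · simp [fibFrieze.row_zero (Int.lt_add_one_iff.1 (emod_lt m))]
  · simpa using fibFrieze.pos i.cast_nonneg
  · zify [hi]
    rw [cast_toNat _ (by lia), cast_toNat _ (by lia), cast_toNat _ (by lia),
      cast_toNat _ (by lia)]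
    rcases Int.add_one_emod_cases m (show (0 : ℤ) ≤ n by lia) with ⟨h, h'⟩ | ⟨h, h'⟩
    · rw [h']
      exact fibFrieze.mul_succ (by lia) (emod_nonneg m) h
    · rw [h, h']
      exact fibFrieze.mul_wrap (by lia) (by lia)
  · zify [hn]
    rw [cast_toNat _ (by lia), cast_toNat _ (by lia), cast_toNat _ (by lia)]
    rcases Int.add_one_emod_cases m (show (0 : ℤ) ≤ n by lia) with ⟨h, h'⟩ | ⟨h, h'⟩
    · rw [h']
      exact fibFrieze.last_mul_succ (emod_nonneg m) h
    · rw [h, h']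
      exact fibFrieze.last_mul_wrap hn'
  · simp only [Int.zero_emod, fibFrieze.col_zero]
    exact congrArg Int.toNat (Int.fib_natCast (2 * i + 1))
end

section
/- Let n ≥ 2 be an integer and let (a_1,…,a_n) be an n-tuple of positive integers satisfying condition (*). If i ∈ {1,…,n} is an index such that a_i = a_{i-1} + a_{i+1} (with the conventions a_0 = a_{n+1} = 1), then the (n-1)-tuple (a_1,…,a_{i-1}, a_{i+1},…,a_n) obtained by deleting the entry a_i also satisfies condition (*). -/
/-- Let `n ≥ 2` and let `a` be an `n`-tuple of positive integers (with the conventions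
`a 0 = a (n+1) = 1`) satisfying condition (*). If `1 ≤ i ≤ n` is an index such that
`a i = a (i-1) + a (i+1)`, then the `(n-1)`-tuple obtained by deleting the entry `a i`
(namely `k ↦ if k < i then a k else a (k+1)`, whose values `1` at the boundary
positions `0` and `n` are inherited from `a`) also satisfies condition (*). -/
theorem deleted_tuple_satisfies_star (n : ℕ) (hn : 2 ≤ n) (a : ℕ → ℕ)
    (h0 : a 0 = 1) (hlast : a (n + 1) = 1)
    (hpos : ∀ k : ℕ, 1 ≤ k → k ≤ n → 0 < a k)
    (hstar : ∀ k : ℕ, 1 ≤ k → k ≤ n → a k ∣ a (k - 1) + a (k + 1))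
    (i : ℕ) (hi1 : 1 ≤ i) (hi2 : i ≤ n) (hsum : a i = a (i - 1) + a (i + 1)) :
    ∀ j : ℕ, 1 ≤ j → j ≤ n - 1 →
      (if j < i then a j else a (j + 1)) ∣
        (if j - 1 < i then a (j - 1) else a j) +
          (if j + 1 < i then a (j + 1) else a (j + 2)) := by
  intro j hj1 hj2
  rcases lt_trichotomy (j + 1) i with h | h | h
  · rw [if_pos (by omega), if_pos (by omega), if_pos h]
    exact hstar j hj1 (by omega)
  · subst h
    rw [if_pos (by omega), if_pos (by omega), if_neg (by omega)]
    have hd := hstar j hj1 (by omega)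
    rw [hsum, Nat.add_sub_cancel, Nat.add_left_comm] at hd
    exact (Nat.dvd_add_right dvd_rfl).mp hd
  · rw [if_neg (by omega : ¬ j < i), if_neg (by omega : ¬ j + 1 < i)]
    have hd := hstar (j + 1) (by omega) (by omega)
    rw [Nat.add_sub_cancel] at hd
    split_ifs with hji
    · obtain rfl : j = i := by omega
      rw [hsum, Nat.add_right_comm] at hd
      exact (Nat.dvd_add_left dvd_rfl).mp hd
    · exact hd
end

section
/- Let n be a positive integer. A frieze pattern of type A_n is uniquely determined by any single one of its diagonals: if f and g are frieze patterns of type A_n and there exists an integer m₀ such that f(i, m₀) = g(i, m₀) for all i ∈ {1,…,n}, then f(i,m) = g(i,m) for all i ∈ {1,…,n} and all m ∈ ℤ. -/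
/-- If two friezes agree on the diagonal at `m`, they agree on the next one. -/
theorem IsFriezeA.eq_succ_diagonal {n : ℕ} {f g : ℕ × ℤ → ℕ} (hf : IsFriezeA n f)
    (hg : IsFriezeA n g) {m : ℤ} (h : ∀ i ≤ n + 1, f (i, m) = g (i, m)) :
    ∀ i ≤ n + 1, f (i, m + 1) = g (i, m + 1) := by
  obtain ⟨hf0, hf1, hfp, hfd⟩ := hf
  obtain ⟨hg0, hg1, -, hgd⟩ := hg
  intro i
  induction i with
  | zero => intro _; rw [hf0, hg0]
  | succ i ih =>
    intro hi
    obtain rfl | hin := eq_or_ne i n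
    · rw [hf1, hg1]
    · have hF := hfd (i + 1) (by omega) (by omega) m
      have hG := hgd (i + 1) (by omega) (by omega) m
      rw [Nat.add_sub_cancel] at hF hG
      rw [← h (i + 1) hi, ← h (i + 1 + 1) (by omega), ← ih (by omega), ← hF] at hG
      exact (Nat.eq_of_mul_eq_mul_left (hfp (i + 1) (by omega) (by omega) m) hG).symm

/-- If two friezes agree on the diagonal at `m + 1`, they agree on the previous one. -/
theorem IsFriezeA.eq_pred_diagonal {n : ℕ} {f g : ℕ × ℤ → ℕ} (hf : IsFriezeA n f)
    (hg : IsFriezeA n g) {m : ℤ} (h : ∀ i ≤ n + 1, f (i, m + 1) = g (i, m + 1)) :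
    ∀ i ≤ n + 1, f (i, m) = g (i, m) := by
  obtain ⟨hf0, hf1, hfp, hfd⟩ := hf
  obtain ⟨hg0, hg1, -, hgd⟩ := hg
  intro i hi
  induction hi using Nat.decreasingInduction with
  | self => rw [hf1, hg1]
  | of_succ i hi ih =>
    obtain rfl | hi0 := Nat.eq_zero_or_pos i
    · rw [hf0, hg0]
    · have hF := hfd i hi0 (by omega) m
      have hG := hgd i hi0 (by omega) m
      rw [← h i (by omega), ← h (i - 1) (by omega), ← ih, ← hF] at hG
      exact (Nat.eq_of_mul_eq_mul_right (hfp i hi0 (by omega) (m + 1)) hG).symm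

/-- A frieze pattern of type `Aₙ` is uniquely determined by any one of its diagonals:
if two frieze patterns of type `Aₙ` agree on the diagonal at some `m₀`, they agree
everywhere. -/
theorem frieze_A_determined_by_diagonal (n : ℕ) (hn : 0 < n)
    (f g : ℕ × ℤ → ℕ) (hf : IsFriezeA n f) (hg : IsFriezeA n g)
    (m₀ : ℤ) (h : ∀ i : ℕ, 1 ≤ i → i ≤ n → f (i, m₀) = g (i, m₀)) :
    ∀ i : ℕ, 1 ≤ i → i ≤ n → ∀ m : ℤ, f (i, m) = g (i, m) := by
  have h₀ : ∀ i ≤ n + 1, f (i, m₀) = g (i, m₀) := by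
    intro i hi
    obtain rfl | hi0 := Nat.eq_zero_or_pos i
    · rw [hf.1, hg.1]
    · obtain rfl | hin := eq_or_ne i (n + 1)
      · rw [hf.2.1, hg.2.1]
      · exact h i hi0 (by omega)
  intro i _ hi m
  suffices H : ∀ i ≤ n + 1, f (i, m) = g (i, m) from H i (by omega)
  induction m using Int.inductionOn' (b := m₀) with
  | zero => exact h₀
  | succ k _ ih => exact hf.eq_succ_diagonal hg ih
  | pred k _ ih => exact hf.eq_pred_diagonal hg (by simpa using ih)
end

section
/- Let n be a positive integer and let (a_1,…,a_n) be an n-tuple of positive integers such that a_{i-1} + a_{i+1} ≥ 2·a_i for all i ∈ {1,…,n}, where by convention a_0 = a_{n+1} = 1. Then a_n = 1. -/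
/-- If an `n`-tuple of positive integers (encoded as `a : ℕ → ℕ` with the conventions
`a 0 = a (n+1) = 1` and `a i > 0` for `1 ≤ i ≤ n`) satisfies
`a (i-1) + a (i+1) ≥ 2 * a i` for all `1 ≤ i ≤ n`, then `a n = 1`. -/
theorem last_entry_eq_one_of_convex (n : ℕ) (hn : 0 < n) (a : ℕ → ℕ)
    (h0 : a 0 = 1) (hlast : a (n + 1) = 1)
    (hpos : ∀ i : ℕ, 1 ≤ i → i ≤ n → 0 < a i)
    (hconv : ∀ i : ℕ, 1 ≤ i → i ≤ n → 2 * a i ≤ a (i - 1) + a (i + 1)) :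
    a n = 1 := by
  have hmono : ∀ i : ℕ, i ≤ n → a i ≤ a (i + 1) := by
    intro i
    induction i with
    | zero =>
      intro _
      rw [h0]
      exact hpos 1 le_rfl hn
    | succ k ih =>
      intro hk
      have hle := ih (by omega)
      have hc := hconv (k + 1) (by omega) hk
      rw [Nat.add_sub_cancel] at hc
      omega
  have hle := hmono n le_rfl
  have hp := hpos n hn le_rfl
  omega
end
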